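/- arXiv:1607.03199 — 3 statements merged into one kernel-verified Lean document; each statement's English description precedes it below -/
import Mathlib

section
/- For odd n, p(n/2) + p_2(n) is interpreted with p(n/2) = 0; for all n ≥ 0, p(n) + p_2(2n) is even. -/
noncomputable def partp (n : ℕ) : ℕ := Fintype.card (Nat.Partition n)

noncomputable def partp2 (n : ℕ) : ℕ :=
  ∑ k ∈ Finset.range (n + 1), partp k * partp (n - k)

theorem sum_range_mul_reflect_two_mul {R : Type*} [CommSemiring R] (f : ℕ → R) (n : ℕ) :
    ∑ k ∈ Finset.range (2 * n + 1), f k * f (2 * n - k) =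
      f n * f n + 2 * ∑ k ∈ Finset.range n, f k * f (2 * n - k) := by
  have upper : ∑ k ∈ Finset.range n, f (n + (k + 1)) * f (2 * n - (n + (k + 1))) =
      ∑ k ∈ Finset.range n, f k * f (2 * n - k) := by
    rw [← Finset.sum_range_reflect]
    refine Finset.sum_congr rfl fun k hk => ?_
    have hk := Finset.mem_range.mp hk
    rw [mul_comm, show n + (n - 1 - k + 1) = 2 * n - k by lia,
      show 2 * n - (2 * n - k) = k by lia]
  rw [show 2 * n + 1 = n + (n + 1) by ring, Finset.sum_range_add, Finset.sum_range_succ', upper,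
    show 2 * n - (n + 0) = n by lia, add_zero]
  ring

theorem stmt4 (n : ℕ) : Even (partp n + partp2 (2 * n)) := by
  rw [partp2, sum_range_mul_reflect_two_mul, ← add_assoc, add_comm (partp n), ← Nat.mul_succ]
  exact (Nat.even_mul_succ_self _).add (even_two_mul _)
end

section
/- If 24n ≡ 1 (mod 5^j) for some j ≥ 1, then p(n) ≡ 0 (mod 5^j), where p is the partition function. -/
open PowerSeries

namespace RamanujanWatson

/-- Replaces `X` by `X ^ 5`. -/
noncomputable abbrev dilate {R : Type*} [CommRing R] : R⟦X⟧ →ₐ[R] R⟦X⟧ :=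
  expand 5 (by norm_num)

/-- Extracts the coefficients whose index is congruent to `r` modulo `5`. -/
noncomputable def section5 (r : ℕ) : ℤ⟦X⟧ →ₗ[ℤ] ℤ⟦X⟧ where
  toFun f := PowerSeries.mk fun n ↦ coeff (5 * n + r) f
  map_add' f g := by ext; simp
  map_smul' c f := by
    ext
    simp only [coeff_mk, map_zsmul, RingHom.id_apply]

@[simp]
theorem coeff_section5 (r n : ℕ) (f : ℤ⟦X⟧) :
    coeff n (section5 r f) = coeff (5 * n + r) f := by
  simp [section5]

theorem dilate_injective {R : Type*} [CommRing R] :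
    Function.Injective (dilate : R⟦X⟧ →ₐ[R] R⟦X⟧) := fun f g h ↦ by
  ext n
  rw [← coeff_expand_mul 5 (by norm_num) f, ← coeff_expand_mul 5 (by norm_num) g]
  exact congrArg _ h

theorem section5_X_pow_mul_dilate (r s : ℕ) (hr : r < 5) (hs : s < 5) (f : ℤ⟦X⟧) :
    section5 r (X ^ s * dilate f) = if r = s then f else 0 := by
  ext n
  rw [coeff_section5, coeff_X_pow_mul', coeff_expand]
  by_cases h : r = s
  · subst h
    simp
  · rw [if_neg h, map_zero, ite_eq_right_iff]
    intro h1
    rw [if_neg]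
    omega

theorem section5_sum (r : ℕ) (hr : r < 5) (f : ℕ → ℤ⟦X⟧) :
    section5 r (∑ s ∈ Finset.range 5, X ^ s * dilate (f s)) = f r := by
  rw [map_sum, Finset.sum_congr rfl fun s hs ↦
    section5_X_pow_mul_dilate r s hr (Finset.mem_range.mp hs) (f s)]
  simp [hr]

theorem sum_section5 (f : ℤ⟦X⟧) :
    ∑ s ∈ Finset.range 5, X ^ s * dilate (section5 s f) = f := by
  ext n
  have key (s : ℕ) (hs : s < 5) : coeff n (X ^ s * dilate (section5 s f)) =
      if s = n % 5 then coeff n f else 0 := by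
    rw [coeff_X_pow_mul', coeff_expand]
    split_ifs with h1 h2 h3 h3 h3
    · rw [coeff_section5]; congr 2; omega
    · omega
    · omega
    · rfl
    · omega
    · rfl
  rw [map_sum, Finset.sum_congr rfl fun s hs ↦ key s (Finset.mem_range.mp hs)]
  simp [Nat.mod_lt]

theorem section5_zero_dilate_mul (f g : ℤ⟦X⟧) :
    section5 0 (dilate f * g) = f * section5 0 g := by
  have h := section5_sum 0 (by norm_num) fun s ↦ f * section5 s g
  rw [← h]
  conv_lhs => rw [← sum_section5 g, Finset.mul_sum]
  congr 1
  refine Finset.sum_congr rfl fun s _ ↦ ?_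
  rw [map_mul]
  ring

/-- The Euler product `∏ (1 - X ^ n)`. -/
noncomputable abbrev euler : ℤ⟦X⟧ := pentagonalSeries ℤ

/-- The generating series of the partition numbers. -/
noncomputable def partSeries : ℤ⟦X⟧ := PowerSeries.mk fun n ↦ (partp n : ℤ)

theorem euler_mul_partSeries : euler * partSeries = 1 := by
  let : TopologicalSpace ℤ := ⊥
  have : DiscreteTopology ℤ := ⟨rfl⟩
  open scoped PowerSeries.WithPiTopology in
  have h1 := Nat.Partition.hasProd_genFun (R := ℤ) (fun _ _ ↦ 1)
  have h2 := WithPiTopology.hasProd_one_sub_X_pow ℤ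
  have h3 := h2.mul h1
  have h4 : Nat.Partition.genFun (R := ℤ) (fun _ _ ↦ 1) = partSeries := by
    ext n
    simp [partSeries, partp, Finsupp.prod]
  rw [h4] at h3
  refine h3.unique ?_
  convert hasProd_one with i
  have h5 := WithPiTopology.tsum_pow_mul_one_sub_of_constantCoeff_eq_zero (R := ℤ)
    (f := X ^ (i + 1)) (by simp)
  have h6 := WithPiTopology.summable_pow_of_constantCoeff_eq_zero (R := ℤ)
    (f := X ^ (i + 1)) (by simp)
  rw [h6.tsum_eq_zero_add, mul_comm] at h5
  rw [← h5, pow_zero]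
  congr! 5 with j
  rw [pow_mul]
  exact one_smul ℤ _

theorem coeff_euler_eq_zero {n : ℕ} (h : ∀ k : ℤ, (2 * n : ℤ) ≠ k * (3 * k - 1)) :
    coeff n euler = 0 := by
  refine coeff_pentagonalSeries_eq_zero ℤ ?_
  rintro ⟨k, rfl⟩
  exact h k (two_mul_natCast_pentagonal k)

theorem pentagonal_mod_five {n k : ℤ} (h : 2 * n = k * (3 * k - 1)) :
    n % 5 = 0 ∨ n % 5 = 2 ∨ n % 5 = 1 ∧ k % 5 = 1 := by
  obtain ⟨m, r, hr0, hr5, rfl⟩ : ∃ m r, 0 ≤ r ∧ r < 5 ∧ k = 5 * m + r :=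
    ⟨k / 5, k % 5, by omega, by omega, by omega⟩
  have h' : 2 * n = 5 * (15 * m ^ 2 + 6 * m * r - m) + r * (3 * r - 1) := by rw [h]; ring
  generalize 15 * m ^ 2 + 6 * m * r - m = t at h'
  interval_cases r <;> omega

theorem section5_three_euler : section5 3 euler = 0 := by
  ext n
  rw [coeff_section5]
  refine coeff_euler_eq_zero fun k hk ↦ ?_
  have := pentagonal_mod_five hk
  omega

theorem section5_four_euler : section5 4 euler = 0 := by
  ext n
  rw [coeff_section5]
  refine coeff_euler_eq_zero fun k hk ↦ ?_
  have := pentagonal_mod_five hk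
  omega

theorem section5_one_euler : section5 1 euler = - dilate euler := by
  ext n
  rw [coeff_section5, map_neg]
  by_cases h : ∃ k : ℤ, pentagonal k = 5 * n + 1
  · obtain ⟨k, hk⟩ := h
    have hk2 := two_mul_natCast_pentagonal k
    have h1 : k % 5 = 1 := by
      have := pentagonal_mod_five hk2
      omega
    obtain ⟨m, rfl⟩ : ∃ m, k = 1 - 5 * m := ⟨(1 - k) / 5, by omega⟩
    have hm := two_mul_natCast_pentagonal m
    have hn : n = 5 * pentagonal m := by
      zify at hk ⊢
      linarith
    rw [← hk, hn, coeff_expand_mul, coeff_pentagonalSeries_pentagonal,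
      coeff_pentagonalSeries_pentagonal,
      show 1 - 5 * m = m + (2 * (-3 * m) + 1) by ring, Int.negOnePow_add, Int.negOnePow_succ,
      Int.negOnePow_two_mul]
    simp
  · rw [coeff_pentagonalSeries_eq_zero ℤ (by simpa using h), coeff_expand]
    split_ifs with h5
    · rw [coeff_euler_eq_zero, neg_zero]
      intro k hk
      apply h
      use 1 - 5 * k
      have := two_mul_natCast_pentagonal (1 - 5 * k)
      obtain ⟨m, rfl⟩ := h5
      rw [Nat.mul_div_cancel_left _ (by norm_num)] at hk
      zify
      linarith
    · simp

theorem euler_dissection : euler = dilate (section5 0 euler) - X * dilate (dilate euler) +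
    X ^ 2 * dilate (section5 2 euler) := by
  conv_lhs => rw [← sum_section5 euler]
  simp only [Finset.sum_range_succ, Finset.sum_range_zero, section5_one_euler,
    section5_three_euler, section5_four_euler, map_neg, map_zero]
  ring

/-- The finite product `∏_{i < n} (1 - X ^ (i + 1))`. -/
noncomputable def eulerTrunc (R : Type*) [CommRing R] (n : ℕ) : R⟦X⟧ :=
  ∏ i ∈ Finset.range n, (1 - X ^ (i + 1))

theorem eventually_X_pow_dvd_sub (R : Type*) [CommRing R] (M : ℕ) :
    ∀ᶠ n in Filter.atTop, X ^ M ∣ pentagonalSeries R - eulerTrunc R n := by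
  have h (m : ℕ) := Filter.tendsto_finset_range.eventually
    (coeff_prod_one_sub_X_pow_eventually_eq R m)
  have h' := (Filter.eventually_all_finset (Finset.range M)).mpr fun m _ ↦ h m
  filter_upwards [h'] with n hn
  rw [X_pow_dvd_iff]
  intro m hm
  rw [map_sub, ← hn m (Finset.mem_range.mpr hm), eulerTrunc, sub_self]

theorem eq_of_forall_X_pow_dvd_sub {R : Type*} [CommRing R] {f g : R⟦X⟧}
    (h : ∀ M, X ^ M ∣ f - g) : f = g := by
  ext n
  have := X_pow_dvd_iff.mp (h (n + 1)) n (Nat.lt_succ_self n)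
  rwa [map_sub, sub_eq_zero] at this

theorem eulerTrunc_succ (R : Type*) [CommRing R] (n : ℕ) :
    eulerTrunc R (n + 1) = eulerTrunc R n * (1 - X ^ (n + 1)) :=
  Finset.prod_range_succ _ _

@[simp]
theorem eulerTrunc_zero (R : Type*) [CommRing R] : eulerTrunc R 0 = 1 :=
  Finset.prod_range_zero _

theorem isUnit_eulerTrunc (n : ℕ) : IsUnit (eulerTrunc ℤ n) := by
  simp [isUnit_iff_constantCoeff, eulerTrunc]

/-- The triangular numbers `m (m + 1) / 2`, indexed by the integers. -/
def triangular (m : ℤ) : ℕ := (m * (m + 1) / 2).toNat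

theorem two_mul_triangular (m : ℤ) : 2 * (triangular m : ℤ) = m * (m + 1) := by
  have h : 0 ≤ m * (m + 1) := by
    rcases lt_or_ge m 0 with h | h
    · exact mul_nonneg_of_nonpos_of_nonpos h.le (by omega)
    · positivity
  rw [triangular, Int.toNat_of_nonneg (Int.ediv_nonneg h (by norm_num)),
    Int.two_mul_ediv_two_of_even (Int.even_mul_succ_self m)]

theorem triangular_add_one (m : ℤ) : (triangular (m + 1) : ℤ) = triangular m + (m + 1) := by
  linarith [two_mul_triangular m, two_mul_triangular (m + 1)]

theorem abs_le_triangular_add_one (m : ℤ) : |m| ≤ triangular m + 1 := by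
  have := two_mul_triangular m
  rcases abs_cases m with ⟨h, _⟩ | ⟨h, _⟩ <;> rw [h] <;> nlinarith

theorem triangular_mod_five (m : ℤ) : triangular m % 5 ≠ 2 := by
  have h := two_mul_triangular m
  obtain ⟨t, r, hr0, hr5, rfl⟩ : ∃ t r, 0 ≤ r ∧ r < 5 ∧ m = 5 * t + r :=
    ⟨m / 5, m % 5, by omega, by omega, by omega⟩
  have h' : 2 * (triangular (5 * t + r) : ℤ) = 5 * (5 * t ^ 2 + 2 * t * r + t) + r * (r + 1) := by
    rw [h]; ring
  generalize 5 * t ^ 2 + 2 * t * r + t = u at h'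
  interval_cases r <;> omega

/-- The finite Jacobi product `∏_{i < a} (z - X ^ i) * ∏_{i < b} (1 - X ^ (i + 1) * z)`. -/
noncomputable def jacobiProd (a b : ℕ) : Polynomial ℤ⟦X⟧ :=
  (∏ i ∈ Finset.range a, (Polynomial.X - Polynomial.C (X ^ i))) *
    ∏ i ∈ Finset.range b, (1 - Polynomial.C (X ^ (i + 1)) * Polynomial.X)

theorem jacobiProd_zero_zero : jacobiProd 0 0 = 1 := by simp [jacobiProd]

theorem jacobiProd_succ_zero (a : ℕ) :
    jacobiProd (a + 1) 0 = jacobiProd a 0 * (Polynomial.X - Polynomial.C (X ^ a)) := by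
  simp [jacobiProd, Finset.prod_range_succ]

theorem jacobiProd_succ (a b : ℕ) :
    jacobiProd a (b + 1) = jacobiProd a b * (1 - Polynomial.C (X ^ (b + 1)) * Polynomial.X) := by
  simp [jacobiProd, Finset.prod_range_succ, mul_assoc]

theorem natDegree_jacobiProd_le (a b : ℕ) : (jacobiProd a b).natDegree ≤ a + b := by
  refine Polynomial.natDegree_mul_le.trans (add_le_add ?_ ?_)
  · refine (Polynomial.natDegree_prod_le _ _).trans ((Finset.sum_le_card_nsmul _ _ 1 ?_).trans
      (by simp))
    intro i _
    exact Polynomial.natDegree_X_sub_C_le _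
  · refine (Polynomial.natDegree_prod_le _ _).trans ((Finset.sum_le_card_nsmul _ _ 1 ?_).trans
      (by simp))
    intro i _
    compute_degree

theorem coeff_jacobiProd_zero (a k l : ℕ) (h : k + l = a) :
    (jacobiProd a 0).coeff k * eulerTrunc ℤ k * eulerTrunc ℤ l =
      (-1) ^ (a + k) * X ^ triangular (k - a) * eulerTrunc ℤ a := by
  induction a generalizing k l with
  | zero =>
    obtain ⟨rfl, rfl⟩ : k = 0 ∧ l = 0 := by omega
    simp [jacobiProd_zero_zero, triangular]
  | succ a ih =>
    rw [jacobiProd_succ_zero, mul_sub, Polynomial.coeff_sub, Polynomial.coeff_mul_C]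
    rcases k with _ | k
    · obtain rfl : l = a + 1 := by omega
      have ht : triangular ((0 : ℕ) - (a : ℕ) : ℤ) + a =
          triangular ((0 : ℕ) - (a + 1 : ℕ) : ℤ) := by
        have := triangular_add_one ((0 : ℕ) - (a + 1 : ℕ) : ℤ)
        rw [show ((0 : ℕ) - (a + 1 : ℕ) : ℤ) + 1 = (0 : ℕ) - (a : ℕ) by push_cast; ring] at this
        omega
      rw [Polynomial.coeff_mul_X_zero, ← ht, eulerTrunc_succ]
      linear_combination -X ^ a * (1 - X ^ (a + 1)) * ih 0 a (by omega)
    rw [Polynomial.coeff_mul_X]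
    rcases l with _ | l
    · obtain rfl : k = a := by omega
      rw [Polynomial.coeff_eq_zero_of_natDegree_lt
        ((natDegree_jacobiProd_le k 0).trans_lt (Nat.lt_succ_self k)), eulerTrunc_succ]
      have := ih k 0 (by omega)
      simp only [sub_self] at this ⊢
      linear_combination (1 - X ^ (k + 1)) * this
    · obtain rfl : a = k + l + 1 := by omega
      have ht : triangular (k - (k + l + 1 : ℕ)) =
          triangular ((k + 1 : ℕ) - (k + l + 1 : ℕ)) + l := by
        have := triangular_add_one (k - (k + l + 1 : ℕ))
        rw [show (k - (k + l + 1 : ℕ) : ℤ) + 1 = (k + 1 : ℕ) - (k + l + 1 : ℕ) by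
          push_cast; ring] at this
        omega
      have h1 := ih k (l + 1) (by omega)
      have h2 := ih (k + 1) l (by omega)
      rw [show ((k + 1 : ℕ) - (k + l + 1 + 1 : ℕ) : ℤ) = k - (k + l + 1 : ℕ) by push_cast; ring]
      rw [ht] at h1 ⊢
      rw [eulerTrunc_succ] at h1 h2
      rw [eulerTrunc_succ ℤ k, eulerTrunc_succ ℤ l, eulerTrunc_succ ℤ (k + l + 1)]
      linear_combination (1 - X ^ (k + 1)) * h1 - X ^ (k + l + 1) * (1 - X ^ (l + 1)) * h2

/-- The finite form of the Jacobi triple product identity. -/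
theorem coeff_jacobiProd (a b k l : ℕ) (h : k + l = a + b) :
    (jacobiProd a b).coeff k * eulerTrunc ℤ k * eulerTrunc ℤ l =
      (-1) ^ (a + k) * X ^ triangular (k - a) * eulerTrunc ℤ (a + b) := by
  induction b generalizing k l with
  | zero => exact coeff_jacobiProd_zero a k l h
  | succ b ih =>
    rw [jacobiProd_succ, mul_sub, mul_one, mul_left_comm, Polynomial.coeff_sub,
      Polynomial.coeff_C_mul, ← add_assoc]
    rcases k with _ | k
    · obtain rfl : l = a + b + 1 := by omega
      rw [Polynomial.coeff_mul_X_zero, eulerTrunc_succ]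
      linear_combination (1 - X ^ (a + b + 1)) * ih 0 (a + b) (by omega)
    rw [Polynomial.coeff_mul_X]
    rcases l with _ | l
    · obtain rfl : k = a + b := by omega
      have ht := triangular_add_one ((a + b : ℕ) - a)
      rw [show ((a + b : ℕ) - a : ℤ) + 1 = (a + b + 1 : ℕ) - a by push_cast; ring] at ht
      have ht' : triangular ((a + b + 1 : ℕ) - a) = triangular ((a + b : ℕ) - a) + (b + 1) := by
        omega
      rw [Polynomial.coeff_eq_zero_of_natDegree_lt
        ((natDegree_jacobiProd_le a b).trans_lt (Nat.lt_succ_self _)), eulerTrunc_succ, ht']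
      linear_combination -X ^ (b + 1) * (1 - X ^ (a + b + 1)) * ih (a + b) 0 (by omega)
    · have ht := triangular_add_one (k - a)
      rw [show (k - a : ℤ) + 1 = (k + 1 : ℕ) - a by push_cast; ring] at ht
      have hX : (X : ℤ⟦X⟧) ^ (b + 1) * X ^ triangular (k - a) =
          X ^ triangular ((k + 1 : ℕ) - a) * X ^ (l + 1) := by
        rw [← pow_add, ← pow_add]
        congr 1
        omega
      have h1 := ih (k + 1) l (by omega)
      have h2 := ih k (l + 1) (by omega)
      have hab : a + b + 1 = (k + 1) + (l + 1) := by omega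
      rw [eulerTrunc_succ] at h1 h2
      rw [eulerTrunc_succ ℤ k, eulerTrunc_succ ℤ l, eulerTrunc_succ ℤ (a + b), hab]
      linear_combination (1 - X ^ (l + 1)) * h1 - X ^ (b + 1) * (1 - X ^ (k + 1)) * h2 +
        (-1) ^ (a + k + 1) * (1 - X ^ (k + 1)) * eulerTrunc ℤ (a + b) * hX

theorem sum_coeff_jacobiProd (n : ℕ) :
    ∑ k ∈ Finset.range (2 * n + 2), (jacobiProd (n + 1) n).coeff k * (k : ℤ⟦X⟧) =
      eulerTrunc ℤ n ^ 2 := by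
  have h : (jacobiProd (n + 1) n).derivative.eval 1 = eulerTrunc ℤ n ^ 2 := by
    rw [jacobiProd, Finset.prod_range_succ', pow_zero, Polynomial.derivative_mul,
      Polynomial.derivative_mul]
    simp [Polynomial.eval_prod, eulerTrunc, sq]
  rw [← h, Polynomial.derivative_eval, Polynomial.sum_over_range' _ (by simp) (2 * n + 2)]
  · simp
  · have := natDegree_jacobiProd_le (n + 1) n
    omega

theorem exists_X_pow_dvd_euler_pow_three_sub (M : ℕ) : ∃ n : ℕ, (X : ℤ⟦X⟧) ^ M ∣ euler ^ 3 -
    ∑ k ∈ Finset.range (2 * n + 2), (-1) ^ (n + 1 + k) * X ^ triangular (k - (n + 1 : ℕ)) *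
      (k : ℤ⟦X⟧) := by
  obtain ⟨N, hN⟩ := Filter.eventually_atTop.mp (eventually_X_pow_dvd_sub ℤ M)
  let π := Ideal.Quotient.mk (Ideal.span {(X : ℤ⟦X⟧) ^ M})
  have hπ (f g : ℤ⟦X⟧) : π f = π g ↔ X ^ M ∣ f - g := by
    rw [Ideal.Quotient.eq, Ideal.mem_span_singleton]
  have hE (n : ℕ) (hn : N ≤ n) : π (eulerTrunc ℤ n) = π euler := ((hπ _ _).mpr (hN n hn)).symm
  have hunit (n : ℕ) : IsUnit (π (eulerTrunc ℤ n)) := (isUnit_eulerTrunc n).map π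
  refine ⟨N + M, ?_⟩
  set n := N + M with hn
  have key (k : ℕ) (hk : k < 2 * n + 2) : π euler * π ((jacobiProd (n + 1) n).coeff k) =
      π ((-1) ^ (n + 1 + k) * X ^ triangular (k - (n + 1 : ℕ))) := by
    have h := congrArg π (coeff_jacobiProd (n + 1) n k (2 * n + 1 - k) (by omega))
    rcases le_or_gt M (triangular (k - (n + 1 : ℕ))) with hM | hM
    · have h0 : π (X ^ triangular (k - (n + 1 : ℕ))) = 0 := by
        rw [Ideal.Quotient.eq_zero_iff_mem, Ideal.mem_span_singleton]
        exact pow_dvd_pow _ hM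
      rw [map_mul, map_mul, map_mul, map_mul, h0, mul_zero, zero_mul, mul_assoc,
        ((hunit _).mul (hunit _)).mul_left_eq_zero] at h
      rw [h, map_mul, h0, mul_zero, mul_zero]
    · have habs := abs_le.mp (abs_le_triangular_add_one (k - (n + 1 : ℕ)))
      rw [map_mul, map_mul, map_mul, hE _ (by omega), hE _ (by omega), hE _ (by omega)] at h
      rw [mul_comm]
      refine (hE n (by omega) ▸ hunit n).mul_right_cancel h
  rw [← hπ]
  calc π (euler ^ 3) = π euler * π (eulerTrunc ℤ n ^ 2) := by
        rw [map_pow, map_pow, hE n (by omega)]; ring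
    _ = _ := by
      rw [← sum_coeff_jacobiProd, map_sum, map_sum, Finset.mul_sum]
      refine Finset.sum_congr rfl fun k hk ↦ ?_
      rw [map_mul, map_mul, ← mul_assoc, key k (Finset.mem_range.mp hk)]

theorem section5_two_euler_pow_three : section5 2 (euler ^ 3) = 0 := by
  ext m
  rw [coeff_section5, map_zero]
  obtain ⟨n, hn⟩ := exists_X_pow_dvd_euler_pow_three_sub (5 * m + 2 + 1)
  have h := X_pow_dvd_iff.mp hn (5 * m + 2) (Nat.lt_succ_self _)
  rw [map_sub, sub_eq_zero] at h
  rw [h, map_sum]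
  refine Finset.sum_eq_zero fun k _ ↦ ?_
  have hc : ((-1) ^ (n + 1 + k) * X ^ triangular (k - (n + 1 : ℕ)) * (k : ℤ⟦X⟧)) =
      C ((-1) ^ (n + 1 + k) * (k : ℤ)) * X ^ triangular (k - (n + 1 : ℕ)) := by
    simp
    ring
  rw [hc, coeff_C_mul, coeff_X_pow, if_neg, mul_zero]
  have := triangular_mod_five (k - (n + 1 : ℕ))
  omega

theorem section5_zero_euler_mul_section5_two_euler :
    section5 0 euler * section5 2 euler = - dilate euler ^ 2 := by
  set a := section5 0 euler with ha
  set c := section5 2 euler with hc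
  set e := dilate euler with he
  have h : section5 2 (euler ^ 3) = 3 * a * (a * c + e ^ 2) := by
    have h1 := section5_sum 2 (by norm_num) fun s ↦
      if s = 0 then a ^ 3 - 3 * X * e * c ^ 2
      else if s = 1 then - 3 * a ^ 2 * e + X * c ^ 3
      else if s = 2 then 3 * a * (a * c + e ^ 2)
      else if s = 3 then - 6 * a * e * c - e ^ 3 else 3 * a * c ^ 2 + 3 * e ^ 2 * c
    rw [if_neg (by norm_num), if_neg (by norm_num), if_pos rfl] at h1
    rw [← h1]
    congr 1
    conv_lhs => rw [euler_dissection, ← ha, ← hc, ← he]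
    have h3 : dilate (3 : ℤ⟦X⟧) = 3 := map_ofNat dilate 3
    have h6 : dilate (6 : ℤ⟦X⟧) = 6 := map_ofNat dilate 6
    simp [Finset.sum_range_succ, h3, h6]
    ring
  rw [section5_two_euler_pow_three] at h
  have ha0 : a ≠ 0 := fun h0 ↦ by
    have := congrArg (coeff 0) h0
    rw [ha, coeff_section5] at this
    have h1 := coeff_pentagonalSeries_pentagonal ℤ 0
    simp [pentagonal] at h1 this
    simp [h1] at this
  have h3 : (3 : ℤ⟦X⟧) ≠ 0 := fun h0 ↦ by
    have := congrArg (constantCoeff (R := ℤ)) h0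
    rw [map_ofNat, map_zero] at this
    norm_num at this
  have := mul_eq_zero.mp h.symm
  rcases this with h4 | h4
  · exact absurd h4 (mul_ne_zero h3 ha0)
  · linear_combination h4

theorem prod_five_conjugates {R : Type*} [CommRing R] {w : R}
    (hw : 1 + w + w ^ 2 + w ^ 3 + w ^ 4 = 0) (a d c : R) :
    ∏ k ∈ Finset.range 5, (a - w ^ k * d + (w ^ k) ^ 2 * c) =
      a ^ 5 - d ^ 5 + c ^ 5 + 5 * a * c * d ^ 3 - 5 * a ^ 2 * c ^ 2 * d := by
  have h5 : w ^ 5 = 1 := by linear_combination (w - 1) * hw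
  have h1 : (a - w * d + w ^ 2 * c) * (a - w ^ 4 * d + w ^ 3 * c) =
    a ^ 2 + d ^ 2 + c ^ 2 - (w + w ^ 4) * (a * d + c * d) + (w ^ 2 + w ^ 3) * (a * c) := by
    grind
  have h2 : (a - w ^ 2 * d + w ^ 4 * c) * (a - w ^ 3 * d + w * c) =
    a ^ 2 + d ^ 2 + c ^ 2 - (w ^ 2 + w ^ 3) * (a * d + c * d) + (w + w ^ 4) * (a * c) := by
    grind
  have h3 : (w + w ^ 4) + (w ^ 2 + w ^ 3) = -1 := by linear_combination hw
  have h4 : (w + w ^ 4) * (w ^ 2 + w ^ 3) = -1 := by grind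
  calc _ = (a - d + c) * ((a - w * d + w ^ 2 * c) * (a - w ^ 4 * d + w ^ 3 * c)) *
        ((a - w ^ 2 * d + w ^ 4 * c) * (a - w ^ 3 * d + w * c)) := by
        have h6 : w ^ 6 = w := by grind
        have h8 : w ^ 8 = w ^ 3 := by grind
        simp only [Finset.prod_range_succ, Finset.prod_range_zero, ← pow_mul]
        norm_num [h6, h8]
        ring
    _ = _ := by
        rw [h1, h2]
        generalize w + w ^ 4 = s at *
        generalize w ^ 2 + w ^ 3 = t at *
        obtain rfl : t = -1 - s := by linear_combination h3
        grind

theorem exists_fifth_root : ∃ w : ℂ, 1 + w + w ^ 2 + w ^ 3 + w ^ 4 = 0 := by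
  have h := (Complex.isPrimitiveRoot_exp 5 (by norm_num)).geom_sum_eq_zero (by norm_num)
  simp only [Finset.sum_range_succ, Finset.sum_range_zero, pow_zero, pow_one, zero_add] at h
  exact ⟨_, h⟩

theorem geom_sum_pow_eq_zero {R : Type*} [CommRing R] {w : R}
    (hw : 1 + w + w ^ 2 + w ^ 3 + w ^ 4 = 0) {m : ℕ} (hm : ¬ 5 ∣ m) :
    1 + w ^ m + (w ^ m) ^ 2 + (w ^ m) ^ 3 + (w ^ m) ^ 4 = 0 := by
  have h5 : w ^ 5 = 1 := by linear_combination (w - 1) * hw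
  have h : w ^ m = w ^ (m % 5) := by
    conv_lhs => rw [← Nat.div_add_mod m 5, pow_add, pow_mul, h5, one_pow, one_mul]
  rw [h]
  have h1 : m % 5 < 5 := Nat.mod_lt _ (by norm_num)
  have h0 : m % 5 ≠ 0 := fun h ↦ hm (Nat.dvd_of_mod_eq_zero h)
  generalize m % 5 = r at *
  interval_cases r <;> grind

/-- The product of the conjugates of a power series under `X ↦ w ^ k * X` for `k < 5`. -/
noncomputable def norm5 (w : ℂ) : ℂ⟦X⟧ →* ℂ⟦X⟧ where
  toFun f := ∏ k ∈ Finset.range 5, rescale (w ^ k) f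
  map_one' := by simp
  map_mul' f g := by simp [Finset.prod_mul_distrib]

theorem norm5_apply (w : ℂ) (f : ℂ⟦X⟧) :
    norm5 w f = ∏ k ∈ Finset.range 5, rescale (w ^ k) f := rfl

theorem norm5_one_sub_X_pow {w : ℂ} (hw : 1 + w + w ^ 2 + w ^ 3 + w ^ 4 = 0) (m : ℕ) :
    norm5 w (1 - X ^ m) = if 5 ∣ m then (1 - X ^ m) ^ 5 else 1 - X ^ (5 * m) := by
  have h5 : w ^ 5 = 1 := by linear_combination (w - 1) * hw
  have hf (k : ℕ) : rescale (w ^ k) (1 - X ^ m : ℂ⟦X⟧) = 1 - C (w ^ m) ^ k * X ^ m := by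
    rw [map_sub, map_one, map_pow, rescale_X, mul_pow, ← map_pow, ← map_pow, ← pow_mul, ← pow_mul,
      mul_comm k m]
  rw [norm5_apply]
  simp only [hf]
  split_ifs with hm
  · obtain ⟨j, rfl⟩ := hm
    simp [pow_mul, h5]
  · have hw' : 1 + C (w ^ m) + C (w ^ m) ^ 2 + C (w ^ m) ^ 3 + C (w ^ m) ^ 4 = (0 : ℂ⟦X⟧) := by
      have := congrArg C (geom_sum_pow_eq_zero hw hm)
      simpa using this
    have := prod_five_conjugates hw' 1 (X ^ m) 0
    simp only [mul_zero, add_zero] at this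
    rw [this]
    ring

theorem norm5_eulerTrunc {w : ℂ} (hw : 1 + w + w ^ 2 + w ^ 3 + w ^ 4 = 0) (n : ℕ) :
    norm5 w (eulerTrunc ℂ (5 * n)) * dilate (dilate (eulerTrunc ℂ n)) =
      dilate (eulerTrunc ℂ n) ^ 5 * dilate (eulerTrunc ℂ (5 * n)) := by
  induction n with
  | zero => simp
  | succ n ih =>
    have hd (m : ℕ) : dilate (1 - X ^ m : ℂ⟦X⟧) = 1 - X ^ (5 * m) := by
      rw [map_sub, map_one, map_pow, expand_X, ← pow_mul]
    rw [show 5 * (n + 1) = 5 * n + 1 + 1 + 1 + 1 + 1 by ring]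
    simp only [eulerTrunc_succ, map_mul, norm5_one_sub_X_pow hw, hd]
    rw [if_neg (by omega), if_neg (by omega), if_neg (by omega), if_neg (by omega),
      if_pos (by omega), show 5 * n + 1 + 1 + 1 + 1 + 1 = 5 * (n + 1) by ring]
    linear_combination (1 - X ^ (5 * (5 * n + 1))) * (1 - X ^ (5 * (5 * n + 1 + 1))) *
      (1 - X ^ (5 * (5 * n + 1 + 1 + 1))) * (1 - X ^ (5 * (5 * n + 1 + 1 + 1 + 1))) *
      (1 - X ^ (5 * (n + 1))) ^ 5 * (1 - X ^ (5 * (5 * (n + 1)))) * ih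

theorem X_pow_dvd_rescale {M : ℕ} {f : ℂ⟦X⟧} (h : X ^ M ∣ f) (w : ℂ) : X ^ M ∣ rescale w f := by
  rw [X_pow_dvd_iff] at h ⊢
  intro m hm
  rw [coeff_rescale, h m hm, mul_zero]

theorem X_pow_dvd_dilate {M : ℕ} {f : ℂ⟦X⟧} (h : X ^ M ∣ f) : X ^ M ∣ dilate f := by
  rw [X_pow_dvd_iff] at h ⊢
  intro m hm
  rw [coeff_expand]
  split_ifs
  · exact h _ (by omega)
  · rfl

theorem norm5_euler {w : ℂ} (hw : 1 + w + w ^ 2 + w ^ 3 + w ^ 4 = 0) :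
    norm5 w (pentagonalSeries ℂ) * dilate (dilate (pentagonalSeries ℂ)) =
      dilate (pentagonalSeries ℂ) ^ 6 := by
  refine eq_of_forall_X_pow_dvd_sub fun M ↦ ?_
  have hev := eventually_X_pow_dvd_sub ℂ M
  have h5 : Filter.Tendsto (fun n : ℕ ↦ 5 * n) Filter.atTop Filter.atTop :=
    Filter.tendsto_id.const_mul_atTop' (by norm_num)
  obtain ⟨n, hn, hn5⟩ := (hev.and (h5.eventually hev)).exists
  have heq (f g : ℂ⟦X⟧) : Ideal.Quotient.mk (Ideal.span {(X : ℂ⟦X⟧) ^ M}) f =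
      Ideal.Quotient.mk _ g ↔ X ^ M ∣ f - g := by
    rw [Ideal.Quotient.eq, Ideal.mem_span_singleton]
  have hd {f g : ℂ⟦X⟧} (h : X ^ M ∣ f - g) : X ^ M ∣ dilate f - dilate g := by
    rw [← map_sub]; exact X_pow_dvd_dilate h
  have hr {f g : ℂ⟦X⟧} (h : X ^ M ∣ f - g) (w : ℂ) : X ^ M ∣ rescale w f - rescale w g := by
    rw [← map_sub]; exact X_pow_dvd_rescale h w
  rw [← heq, map_mul, map_pow, (heq _ _).mpr (hd (hd hn)), norm5_apply, map_prod,
    Finset.prod_congr rfl fun k _ ↦ (heq _ _).mpr (hr hn5 (w ^ k)), ← map_prod, ← norm5_apply,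
    ← map_mul, norm5_eulerTrunc hw, map_mul, map_pow, ← (heq _ _).mpr (hd hn),
    ← (heq _ _).mpr (hd hn5)]
  ring

theorem rescale_dilate {w : ℂ} (hw : w ^ 5 = 1) (f : ℂ⟦X⟧) : rescale w (dilate f) = dilate f := by
  ext n
  rw [coeff_rescale, coeff_expand]
  split_ifs with h
  · obtain ⟨m, rfl⟩ := h
    rw [pow_mul, hw, one_pow, one_mul]
  · rw [mul_zero]

theorem map_euler : map (Int.castRingHom ℂ) euler = pentagonalSeries ℂ := by
  ext n
  rw [coeff_map]
  by_cases h : n ∈ Set.range pentagonal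
  · obtain ⟨k, rfl⟩ := h
    simp
  · rw [coeff_pentagonalSeries_eq_zero _ h, coeff_pentagonalSeries_eq_zero _ h, map_zero]

theorem euler_pow_six : (section5 0 euler ^ 5 - 11 * X * dilate euler ^ 5 +
    X ^ 2 * section5 2 euler ^ 5) * dilate euler = euler ^ 6 := by
  obtain ⟨w, hw⟩ := exists_fifth_root
  have h5 : w ^ 5 = 1 := by linear_combination (w - 1) * hw
  let φ : ℤ⟦X⟧ →+* ℂ⟦X⟧ := (dilate : ℂ⟦X⟧ →ₐ[ℂ] ℂ⟦X⟧).toRingHom.comp (map (Int.castRingHom ℂ))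
  have hφ : Function.Injective φ := dilate_injective.comp
    (map_injective _ (RingHom.injective_int _))
  have hd (f : ℤ⟦X⟧) : dilate (map (Int.castRingHom ℂ) f) = φ f := rfl
  have hmd (f : ℤ⟦X⟧) : map (Int.castRingHom ℂ) (dilate f) = φ f := map_expand ..
  have hE : pentagonalSeries ℂ = φ (section5 0 euler) - X * φ (dilate euler) +
      X ^ 2 * φ (section5 2 euler) := by
    conv_lhs => rw [← map_euler, euler_dissection]
    rw [map_add, map_sub, map_mul, map_mul, map_pow, map_X, hmd, hmd, hmd]
  have hr (k : ℕ) : rescale (w ^ k) (pentagonalSeries ℂ) = φ (section5 0 euler) -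
      C w ^ k * (X * φ (dilate euler)) + (C w ^ k) ^ 2 * (X ^ 2 * φ (section5 2 euler)) := by
    have hk : (w ^ k) ^ 5 = 1 := by rw [← pow_mul, mul_comm, pow_mul, h5, one_pow]
    have hφr (f : ℤ⟦X⟧) : rescale (w ^ k) (φ f) = φ f := rescale_dilate hk _
    rw [hE, map_add, map_sub, map_mul, map_mul, map_pow, rescale_X, hφr, hφr, hφr, map_pow]
    ring
  have hw' : 1 + C w + C w ^ 2 + C w ^ 3 + C w ^ 4 = (0 : ℂ⟦X⟧) := by
    simpa using congrArg C hw
  have hnorm := norm5_euler hw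
  rw [norm5_apply] at hnorm
  simp only [hr] at hnorm
  have hX : φ X = X ^ 5 := by simp [φ]
  have h11 : φ 11 = 11 := map_ofNat φ 11
  have hac := congrArg φ section5_zero_euler_mul_section5_two_euler
  have hde : dilate (dilate (pentagonalSeries ℂ)) = φ (dilate euler) := by
    rw [← map_euler, ← hd, map_expand]
  have hee : dilate (pentagonalSeries ℂ) = φ euler := by
    rw [← map_euler, hd]
  rw [prod_five_conjugates hw', hde, hee] at hnorm
  apply hφ
  simp only [map_mul, map_add, map_sub, map_pow, map_neg, hX, h11] at hac ⊢
  rw [← hnorm]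
  generalize φ (section5 0 euler) = a at *
  generalize φ (section5 2 euler) = c at *
  generalize φ (dilate euler) = e at *
  linear_combination (-5 * X ^ 5 * e ^ 4 + 5 * X ^ 5 * e ^ 2 * (a * c - e ^ 2)) * hac

theorem dilate_X : dilate (X : ℤ⟦X⟧) = X ^ 5 := expand_X ..

theorem dilate_euler_mul_dilate_partSeries : dilate euler * dilate partSeries = 1 := by
  rw [← map_mul, euler_mul_partSeries, map_one]

theorem dilate_dilate_euler_mul_dilate_dilate_partSeries :
    dilate (dilate euler) * dilate (dilate partSeries) = 1 := by
  rw [← map_mul, dilate_euler_mul_dilate_partSeries, map_one]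

/-- The quotient `X * E(X ^ 25) / E(X)`, where `E` is the Euler product. -/
noncomputable def zeta : ℤ⟦X⟧ := X * dilate (dilate euler) * partSeries

/-- The quotient `X * E(X ^ 5) ^ 6 / E(X) ^ 6`, where `E` is the Euler product. -/
noncomputable def tau : ℤ⟦X⟧ := X * dilate euler ^ 6 * partSeries ^ 6

theorem dilate_tau : dilate tau = X ^ 5 * dilate (dilate euler) ^ 6 * dilate partSeries ^ 6 := by
  simp only [tau, map_mul, map_pow, dilate_X]

theorem dilate_tau_mul_tau : dilate tau * tau = zeta ^ 6 := by
  rw [dilate_tau, tau, zeta]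
  have h : dilate euler ^ 6 * dilate partSeries ^ 6 = 1 := by
    rw [← mul_pow, dilate_euler_mul_dilate_partSeries, one_pow]
  linear_combination X ^ 6 * dilate (dilate euler) ^ 6 * partSeries ^ 6 * h

theorem tau_ne_zero : tau ≠ 0 := by
  have hp : partSeries ≠ 0 := right_ne_zero_of_mul_eq_one euler_mul_partSeries
  have he : dilate euler ≠ 0 := left_ne_zero_of_mul_eq_one dilate_euler_mul_dilate_partSeries
  exact mul_ne_zero (mul_ne_zero X_ne_zero (pow_ne_zero _ he)) (pow_ne_zero _ hp)

theorem dilate_section5_zero_mul_dilate_section5_two :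
    dilate (section5 0 euler) * (X ^ 2 * dilate (section5 2 euler)) =
      -(X * dilate (dilate euler)) ^ 2 := by
  have h := congrArg dilate section5_zero_euler_mul_section5_two_euler
  simp only [map_mul, map_neg, map_pow] at h
  linear_combination X ^ 2 * h

theorem euler_quartic :
    euler ^ 4 + 5 * euler ^ 3 * (X * dilate (dilate euler)) +
      15 * euler ^ 2 * (X * dilate (dilate euler)) ^ 2 +
      25 * euler * (X * dilate (dilate euler)) ^ 3 + 25 * (X * dilate (dilate euler)) ^ 4 =
      partSeries * (dilate euler ^ 6 * dilate (dilate partSeries)) := by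
  have hE := euler_dissection
  have hac := dilate_section5_zero_mul_dilate_section5_two
  have h6 := congrArg dilate euler_pow_six
  have h11 : dilate (11 : ℤ⟦X⟧) = 11 := map_ofNat dilate 11
  simp only [map_mul, map_add, map_sub, map_pow, dilate_X, h11] at h6
  have hp := euler_mul_partSeries
  have hpp := dilate_dilate_euler_mul_dilate_dilate_partSeries
  generalize dilate (section5 0 euler) = x at *
  generalize dilate (section5 2 euler) = c at *
  generalize dilate (dilate euler) = f at *
  generalize dilate (dilate partSeries) = pf at *
  generalize dilate euler = e at *
  generalize euler = E at *
  have key : E ^ 5 + 5 * E ^ 4 * (X * f) + 15 * E ^ 3 * (X * f) ^ 2 + 25 * E ^ 2 * (X * f) ^ 3 +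
      25 * E * (X * f) ^ 4 = x ^ 5 - 11 * (X * f) ^ 5 + (X ^ 2 * c) ^ 5 := by
    rw [hE]
    linear_combination (5 * (x + X ^ 2 * c) ^ 3 +
      5 * (x + X ^ 2 * c) * ((X * f) ^ 2 - x * (X ^ 2 * c))) * hac
  have key2 : x ^ 5 - 11 * (X * f) ^ 5 + (X ^ 2 * c) ^ 5 = e ^ 6 * pf := by
    linear_combination pf * h6 - (x ^ 5 - 11 * (X * f) ^ 5 + (X ^ 2 * c) ^ 5) * hpp
  linear_combination partSeries * (key + key2) - (E ^ 4 + 5 * E ^ 3 * (X * f) +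
    15 * E ^ 2 * (X * f) ^ 2 + 25 * E * (X * f) ^ 3 + 25 * (X * f) ^ 4) * hp

theorem zeta_pow_five : zeta ^ 5 =
    dilate tau * (1 + 5 * zeta + 15 * zeta ^ 2 + 25 * zeta ^ 3 + 25 * zeta ^ 4) := by
  have h := euler_quartic
  have hp := euler_mul_partSeries
  have he : dilate euler ^ 6 * dilate partSeries ^ 6 = 1 := by
    rw [← mul_pow, dilate_euler_mul_dilate_partSeries, one_pow]
  have hpp := dilate_dilate_euler_mul_dilate_dilate_partSeries
  rw [dilate_tau]
  have hz : 1 + 5 * zeta + 15 * zeta ^ 2 + 25 * zeta ^ 3 + 25 * zeta ^ 4 =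
      partSeries ^ 5 * (dilate euler ^ 6 * dilate (dilate partSeries)) := by
    have h2 : euler ^ 2 * partSeries ^ 2 = 1 := by rw [← mul_pow, hp, one_pow]
    have h3 : euler ^ 3 * partSeries ^ 3 = 1 := by rw [← mul_pow, hp, one_pow]
    have h4 : euler ^ 4 * partSeries ^ 4 = 1 := by rw [← mul_pow, hp, one_pow]
    rw [zeta]
    generalize X * dilate (dilate euler) = D at *
    linear_combination partSeries ^ 4 * h - h4 - 5 * D * partSeries * h3 -
      15 * D ^ 2 * partSeries ^ 2 * h2 - 25 * D ^ 3 * partSeries ^ 3 * hp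
  rw [hz, zeta]
  generalize dilate (dilate euler) = f at *
  generalize dilate (dilate partSeries) = pf at *
  generalize dilate partSeries ^ 6 = pe at *
  generalize dilate euler ^ 6 = e at *
  linear_combination -X ^ 5 * f ^ 5 * partSeries ^ 5 * (f * pf * he + hpp)

theorem section5_zero_sum (f₀ f₁ f₂ f₃ f₄ : ℤ⟦X⟧) :
    section5 0 (dilate f₀ + X * dilate f₁ + X ^ 2 * dilate f₂ + X ^ 3 * dilate f₃ +
      X ^ 4 * dilate f₄) = f₀ := by
  have := section5_sum 0 (by norm_num) fun s ↦
    if s = 0 then f₀ else if s = 1 then f₁ else if s = 2 then f₂ else if s = 3 then f₃ else f₄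
  simpa [Finset.sum_range_succ] using this

section EulerPowers

local notation "D" => X * dilate (dilate euler)
local notation "A" => dilate (section5 0 euler)
local notation "B" => X ^ 2 * dilate (section5 2 euler)

theorem euler_sq : euler ^ 2 = A ^ 2 + B ^ 2 - D ^ 2 - 2 * D * A - 2 * D * B := by
  have hE := euler_dissection
  have hac := dilate_section5_zero_mul_dilate_section5_two
  linear_combination (euler + A - D + B) * hE + 2 * hac

theorem euler_pow_three : euler ^ 3 = A ^ 3 + B ^ 3 - 3 * D * A ^ 2 - 3 * D * B ^ 2 +
    5 * D ^ 3 := by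
  have hE := euler_dissection
  have hac := dilate_section5_zero_mul_dilate_section5_two
  linear_combination euler * euler_sq + (A ^ 2 + B ^ 2 - D ^ 2 - 2 * D * A - 2 * D * B) * hE +
    (A + B - 4 * D) * hac

theorem euler_pow_four : euler ^ 4 = A ^ 4 + B ^ 4 - 4 * D * A ^ 3 - 4 * D * B ^ 3 +
    2 * D ^ 2 * A ^ 2 + 2 * D ^ 2 * B ^ 2 + 8 * D ^ 3 * A + 8 * D ^ 3 * B - 5 * D ^ 4 := by
  have hE := euler_dissection
  have hac := dilate_section5_zero_mul_dilate_section5_two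
  linear_combination euler * euler_pow_three +
    (A ^ 3 + B ^ 3 - 3 * D * A ^ 2 - 3 * D * B ^ 2 + 5 * D ^ 3) * hE +
    (A ^ 2 + B ^ 2 - 3 * D * A - 3 * D * B) * hac

theorem dilate_X_mul_dilate_euler_pow : dilate (X * dilate euler ^ 5) = D ^ 5 := by
  rw [map_mul, map_pow, dilate_X]
  ring

theorem section5_zero_euler_mul :
    section5 0 (euler * D ^ 4) = -(X * dilate euler ^ 5) := by
  have hE := euler_dissection
  refine Eq.trans (congrArg _ ?_) (section5_zero_sum _
    (X * (dilate euler ^ 4 * section5 2 euler)) 0 0 (dilate euler ^ 4 * section5 0 euler))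
  simp only [map_neg, map_mul, map_pow, dilate_X, map_zero]
  linear_combination D ^ 4 * hE

theorem section5_zero_euler_sq_mul :
    section5 0 (euler ^ 2 * D ^ 3) = -(X * dilate euler ^ 5) := by
  refine Eq.trans (congrArg _ ?_) (section5_zero_sum _
    (-(X * (dilate euler ^ 4 * section5 2 euler)) - X * (dilate euler ^ 4 * section5 2 euler))
    (X * (dilate euler ^ 3 * section5 2 euler ^ 2))
    (dilate euler ^ 3 * section5 0 euler ^ 2)
    (-(dilate euler ^ 4 * section5 0 euler) - dilate euler ^ 4 * section5 0 euler))
  simp only [map_neg, map_mul, map_pow, dilate_X, map_sub]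
  linear_combination D ^ 3 * euler_sq

theorem section5_zero_euler_pow_three_mul :
    section5 0 (euler ^ 3 * D ^ 2) = (5 : ℤ) • (X * dilate euler ^ 5) := by
  refine Eq.trans (congrArg _ ?_) (section5_zero_sum _ 0
    (dilate euler ^ 2 * section5 0 euler ^ 3 +
      (-3 : ℤ) • (X * (dilate euler ^ 3 * section5 2 euler ^ 2)))
    ((-3 : ℤ) • (dilate euler ^ 3 * section5 0 euler ^ 2) +
      X * (dilate euler ^ 2 * section5 2 euler ^ 3)) 0)
  simp only [map_zero, map_mul, map_pow, dilate_X, map_add, map_zsmul]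
  simp only [zsmul_eq_mul]
  push_cast
  linear_combination D ^ 2 * euler_pow_three

theorem section5_zero_euler_pow_four_mul :
    section5 0 (euler ^ 4 * D) = (-5 : ℤ) • (X * dilate euler ^ 5) := by
  refine Eq.trans (congrArg _ ?_) (section5_zero_sum _
    (dilate euler * section5 0 euler ^ 4 + (8 : ℤ) • (X * (dilate euler ^ 4 * section5 2 euler)))
    ((-4 : ℤ) • (dilate euler ^ 2 * section5 0 euler ^ 3) +
      (2 : ℤ) • (X * (dilate euler ^ 3 * section5 2 euler ^ 2)))
    ((-4 : ℤ) • (X * (dilate euler ^ 2 * section5 2 euler ^ 3)) +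
      (2 : ℤ) • (dilate euler ^ 3 * section5 0 euler ^ 2))
    ((8 : ℤ) • (dilate euler ^ 4 * section5 0 euler) +
      X * (dilate euler * section5 2 euler ^ 4)))
  simp only [map_mul, map_pow, dilate_X, map_add, map_zsmul]
  simp only [zsmul_eq_mul]
  push_cast
  linear_combination D * euler_pow_four

theorem section5_zero_pow_five_mul (f : ℤ⟦X⟧) :
    section5 0 (D ^ 5 * f) = X * dilate euler ^ 5 * section5 0 f := by
  rw [← dilate_X_mul_dilate_euler_pow, section5_zero_dilate_mul]

theorem section5_zero_one : section5 0 1 = 1 := by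
  simpa using section5_zero_sum 1 0 0 0 0

theorem section5_zero_pow_five : section5 0 (D ^ 5) = X * dilate euler ^ 5 := by
  simpa [section5_zero_one] using section5_zero_pow_five_mul 1

theorem zeta_eq : zeta = dilate (partSeries ^ 6 * dilate euler) * (euler ^ 4 * D +
    (5 : ℤ) • (euler ^ 3 * D ^ 2) + (15 : ℤ) • (euler ^ 2 * D ^ 3) + (25 : ℤ) • (euler * D ^ 4) +
    (25 : ℤ) • D ^ 5) := by
  have h := euler_quartic
  have he : dilate euler ^ 6 * dilate partSeries ^ 6 = 1 := by
    rw [← mul_pow, dilate_euler_mul_dilate_partSeries, one_pow]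
  have hpp := dilate_dilate_euler_mul_dilate_dilate_partSeries
  simp only [zsmul_eq_mul, zeta, map_mul, map_pow]
  push_cast
  linear_combination -D * dilate partSeries ^ 6 * dilate (dilate euler) * h -
    D * partSeries * (he * dilate (dilate euler) * dilate (dilate partSeries) + hpp)

theorem tau_eq (f : ℤ⟦X⟧) :
    partSeries ^ 6 * dilate euler * (X * dilate euler ^ 5 * f) = tau * f := by
  rw [tau]; ring

theorem euler_mul_zeta : euler * zeta = D := by
  rw [zeta]
  linear_combination D * euler_mul_partSeries

theorem section5_zero_zeta : section5 0 zeta = (5 : ℤ) • tau := by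
  have h := tau_eq 1
  rw [zeta_eq, section5_zero_dilate_mul]
  simp only [map_add, map_zsmul, section5_zero_euler_mul, section5_zero_euler_sq_mul,
    section5_zero_euler_pow_three_mul, section5_zero_euler_pow_four_mul, section5_zero_pow_five]
  simp only [zsmul_eq_mul]
  push_cast
  linear_combination 5 * h

theorem section5_zero_zeta_sq : section5 0 (zeta ^ 2) =
    (10 : ℤ) • tau + (25 : ℤ) • (tau * section5 0 zeta) := by
  have h : zeta ^ 2 = dilate (partSeries ^ 6 * dilate euler) * (euler ^ 3 * D ^ 2 +
      (5 : ℤ) • (euler ^ 2 * D ^ 3) + (15 : ℤ) • (euler * D ^ 4) + (25 : ℤ) • D ^ 5 +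
      (25 : ℤ) • (D ^ 5 * zeta)) := by
    have h1 := zeta_eq
    have h2 := euler_mul_zeta
    generalize dilate (partSeries ^ 6 * dilate euler) = g at *
    simp only [zsmul_eq_mul] at h1 ⊢
    push_cast at h1 ⊢
    linear_combination zeta * h1 + g * (euler ^ 3 * D + 5 * euler ^ 2 * D ^ 2 +
      15 * euler * D ^ 3 + 25 * D ^ 4) * h2
  have h1 := tau_eq 1
  have h2 := tau_eq (section5 0 zeta)
  rw [h, section5_zero_dilate_mul]
  simp only [map_add, map_zsmul, section5_zero_euler_mul, section5_zero_euler_sq_mul,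
    section5_zero_euler_pow_three_mul, section5_zero_pow_five,
    section5_zero_pow_five_mul]
  simp only [zsmul_eq_mul]
  push_cast
  linear_combination 10 * h1 + 25 * h2

theorem section5_zero_zeta_pow_three : section5 0 (zeta ^ 3) =
    (9 : ℤ) • tau + (25 : ℤ) • (tau * section5 0 zeta) +
      (25 : ℤ) • (tau * section5 0 (zeta ^ 2)) := by
  have h : zeta ^ 3 = dilate (partSeries ^ 6 * dilate euler) * (euler ^ 2 * D ^ 3 +
      (5 : ℤ) • (euler * D ^ 4) + (15 : ℤ) • D ^ 5 + (25 : ℤ) • (D ^ 5 * zeta) +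
      (25 : ℤ) • (D ^ 5 * zeta ^ 2)) := by
    have h1 := zeta_eq
    have h2 := euler_mul_zeta
    have h3 : euler ^ 2 * zeta ^ 2 = D ^ 2 := by rw [← mul_pow, h2]
    generalize dilate (partSeries ^ 6 * dilate euler) = g at *
    simp only [zsmul_eq_mul] at h1 ⊢
    push_cast at h1 ⊢
    linear_combination zeta ^ 2 * h1 + g * (euler ^ 2 * D + 5 * euler * D ^ 2 + 15 * D ^ 3) * h3 +
      25 * g * zeta * D ^ 4 * h2
  have h1 := tau_eq 1
  have h2 := tau_eq (section5 0 zeta)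
  have h3 := tau_eq (section5 0 (zeta ^ 2))
  rw [h, section5_zero_dilate_mul]
  simp only [map_add, map_zsmul, section5_zero_euler_mul, section5_zero_euler_sq_mul,
    section5_zero_pow_five, section5_zero_pow_five_mul]
  simp only [zsmul_eq_mul]
  push_cast
  linear_combination 9 * h1 + 25 * h2 + 25 * h3

theorem section5_zero_zeta_pow_four : section5 0 (zeta ^ 4) =
    (4 : ℤ) • tau + (15 : ℤ) • (tau * section5 0 zeta) +
      (25 : ℤ) • (tau * section5 0 (zeta ^ 2)) + (25 : ℤ) • (tau * section5 0 (zeta ^ 3)) := by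
  have h : zeta ^ 4 = dilate (partSeries ^ 6 * dilate euler) * (euler * D ^ 4 +
      (5 : ℤ) • D ^ 5 + (15 : ℤ) • (D ^ 5 * zeta) + (25 : ℤ) • (D ^ 5 * zeta ^ 2) +
      (25 : ℤ) • (D ^ 5 * zeta ^ 3)) := by
    have h1 := zeta_eq
    have h2 := euler_mul_zeta
    have h3 : euler ^ 3 * zeta ^ 3 = D ^ 3 := by rw [← mul_pow, h2]
    have h4 : euler ^ 2 * zeta ^ 2 = D ^ 2 := by rw [← mul_pow, h2]
    generalize dilate (partSeries ^ 6 * dilate euler) = g at *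
    simp only [zsmul_eq_mul] at h1 ⊢
    push_cast at h1 ⊢
    linear_combination zeta ^ 3 * h1 + g * (euler * D + 5 * D ^ 2) * h3 +
      15 * g * zeta * D ^ 3 * h4 + 25 * g * zeta ^ 2 * D ^ 4 * h2
  have h1 := tau_eq 1
  have h2 := tau_eq (section5 0 zeta)
  have h3 := tau_eq (section5 0 (zeta ^ 2))
  have h4 := tau_eq (section5 0 (zeta ^ 3))
  rw [h, section5_zero_dilate_mul]
  simp only [map_add, map_zsmul, section5_zero_euler_mul,
    section5_zero_pow_five, section5_zero_pow_five_mul]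
  simp only [zsmul_eq_mul]
  push_cast
  linear_combination 4 * h1 + 15 * h2 + 25 * h3 + 25 * h4

end EulerPowers

theorem section5_zero_zeta_pow_add_five (i : ℕ) : section5 0 (zeta ^ (i + 5)) =
    (1 : ℤ) • (tau * section5 0 (zeta ^ i)) + (5 : ℤ) • (tau * section5 0 (zeta ^ (i + 1))) +
      (15 : ℤ) • (tau * section5 0 (zeta ^ (i + 2))) +
      (25 : ℤ) • (tau * section5 0 (zeta ^ (i + 3))) +
      (25 : ℤ) • (tau * section5 0 (zeta ^ (i + 4))) := by
  have h : zeta ^ (i + 5) = dilate tau * (zeta ^ i + (5 : ℤ) • zeta ^ (i + 1) +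
      (15 : ℤ) • zeta ^ (i + 2) + (25 : ℤ) • zeta ^ (i + 3) + (25 : ℤ) • zeta ^ (i + 4)) := by
    simp only [zsmul_eq_mul]
    push_cast
    linear_combination zeta ^ i * zeta_pow_five
  rw [h, section5_zero_dilate_mul]
  simp only [map_add, map_zsmul]
  simp only [zsmul_eq_mul]
  push_cast
  ring

/-- The span of the multiples `5 ^ e j * tau ^ j` with `l ≤ j`. -/
noncomputable def tauSpan (l : ℕ) (e : ℕ → ℕ) : Submodule ℤ ℤ⟦X⟧ :=
  Submodule.span ℤ {f | ∃ j, l ≤ j ∧ f = (5 ^ e j : ℤ) • tau ^ j}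

theorem smul_tau_pow_mem_tauSpan {l : ℕ} {e : ℕ → ℕ} {j : ℕ} {a : ℤ} (hj : l ≤ j)
    (ha : 5 ^ e j ∣ a) : a • tau ^ j ∈ tauSpan l e := by
  obtain ⟨b, rfl⟩ := ha
  rw [mul_comm, mul_smul]
  exact Submodule.smul_mem _ _ (Submodule.subset_span ⟨j, hj, rfl⟩)

theorem map_mem_of_mem_tauSpan {l : ℕ} {e : ℕ → ℕ} {x : ℤ⟦X⟧} (hx : x ∈ tauSpan l e)
    (φ : ℤ⟦X⟧ →ₗ[ℤ] ℤ⟦X⟧) (N : Submodule ℤ ℤ⟦X⟧)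
    (h : ∀ j, l ≤ j → (5 ^ e j : ℤ) • φ (tau ^ j) ∈ N) : φ x ∈ N := by
  have : tauSpan l e ≤ N.comap φ := by
    refine Submodule.span_le.mpr ?_
    rintro _ ⟨j, hj, rfl⟩
    rw [SetLike.mem_coe, Submodule.mem_comap, map_smul]
    exact h j hj
  exact this hx

theorem smul_mem_tauSpan {l l' c : ℕ} {e e' : ℕ → ℕ} {x : ℤ⟦X⟧} (hx : x ∈ tauSpan l e)
    (h : ∀ j, l ≤ j → l' ≤ j ∧ e' j ≤ c + e j) : (5 ^ c : ℤ) • x ∈ tauSpan l' e' := by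
  refine map_mem_of_mem_tauSpan hx (LinearMap.lsmul ℤ ℤ⟦X⟧ (5 ^ c : ℤ)) _ fun j hj ↦ ?_
  rw [LinearMap.lsmul_apply, smul_smul, ← pow_add, add_comm (e j)]
  exact smul_tau_pow_mem_tauSpan (h j hj).1 (pow_dvd_pow _ (h j hj).2)

theorem smul_tau_mul_mem_tauSpan {l l' : ℕ} {e e' : ℕ → ℕ} {x : ℤ⟦X⟧} (hx : x ∈ tauSpan l e)
    (c : ℕ) {a : ℤ} (ha : 5 ^ c ∣ a)
    (h : ∀ j, l ≤ j → l' ≤ j + 1 ∧ e' (j + 1) ≤ c + e j) :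
    a • (tau * x) ∈ tauSpan l' e' := by
  obtain ⟨b, rfl⟩ := ha
  rw [mul_comm, mul_smul]
  refine Submodule.smul_mem _ b (map_mem_of_mem_tauSpan hx
    (LinearMap.lsmul ℤ ℤ⟦X⟧ (5 ^ c : ℤ) ∘ₗ LinearMap.mulLeft ℤ tau) _ fun j hj ↦ ?_)
  rw [LinearMap.comp_apply, LinearMap.lsmul_apply, LinearMap.mulLeft_apply, smul_smul, ← pow_add,
    ← pow_succ', add_comm (e j)]
  exact smul_tau_pow_mem_tauSpan (h j hj).1 (pow_dvd_pow _ (h j hj).2)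

/-- A module containing `section5 0 (zeta ^ s)`. -/
noncomputable abbrev zetaSpan (s : ℕ) : Submodule ℤ ℤ⟦X⟧ :=
  tauSpan ((s + 4) / 5) fun j ↦ (5 * j - s - 1) / 2

theorem section5_zero_zeta_pow_mem (i : ℕ) : section5 0 (zeta ^ i) ∈ zetaSpan i := by
  induction i using Nat.strong_induction_on with
  | _ i ih =>
    match i with
    | 0 =>
      rw [pow_zero, section5_zero_one, ← pow_zero tau, ← one_smul ℤ (tau ^ 0)]
      exact smul_tau_pow_mem_tauSpan (by norm_num) (by norm_num)
    | 1 =>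
      rw [pow_one, section5_zero_zeta, ← pow_one tau]
      exact smul_tau_pow_mem_tauSpan (by norm_num) (by norm_num)
    | 2 =>
      have h1 := ih 1 (by norm_num)
      rw [pow_one] at h1
      rw [section5_zero_zeta_sq]
      refine add_mem ?_ (smul_tau_mul_mem_tauSpan h1 2 (by norm_num) (by omega))
      rw [← pow_one tau]
      exact smul_tau_pow_mem_tauSpan (by norm_num) (by norm_num)
    | 3 =>
      have h1 := ih 1 (by norm_num)
      rw [pow_one] at h1
      rw [section5_zero_zeta_pow_three]
      refine add_mem (add_mem ?_ (smul_tau_mul_mem_tauSpan h1 2 (by norm_num) (by omega)))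
        (smul_tau_mul_mem_tauSpan (ih 2 (by norm_num)) 2 (by norm_num) (by omega))
      rw [← pow_one tau]
      exact smul_tau_pow_mem_tauSpan (by norm_num) (by norm_num)
    | 4 =>
      have h1 := ih 1 (by norm_num)
      rw [pow_one] at h1
      rw [section5_zero_zeta_pow_four]
      refine add_mem (add_mem (add_mem ?_
        (smul_tau_mul_mem_tauSpan h1 1 (by norm_num) (by omega)))
        (smul_tau_mul_mem_tauSpan (ih 2 (by norm_num)) 2 (by norm_num) (by omega)))
        (smul_tau_mul_mem_tauSpan (ih 3 (by norm_num)) 2 (by norm_num) (by omega))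
      rw [← pow_one tau]
      exact smul_tau_pow_mem_tauSpan (by norm_num) (by norm_num)
    | i + 5 =>
      rw [section5_zero_zeta_pow_add_five]
      refine add_mem (add_mem (add_mem (add_mem
        (smul_tau_mul_mem_tauSpan (ih i (by omega)) 0 (by norm_num) (by omega))
        (smul_tau_mul_mem_tauSpan (ih (i + 1) (by omega)) 1 (by norm_num) (by omega)))
        (smul_tau_mul_mem_tauSpan (ih (i + 2) (by omega)) 1 (by norm_num) (by omega)))
        (smul_tau_mul_mem_tauSpan (ih (i + 3) (by omega)) 2 (by norm_num) (by omega)))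
        (smul_tau_mul_mem_tauSpan (ih (i + 4) (by omega)) 2 (by norm_num) (by omega))

theorem mem_zetaSpan_of_tau_pow_mul_mem {i s : ℕ} {x : ℤ⟦X⟧}
    (h : tau ^ i * x ∈ zetaSpan (5 * i + s)) : x ∈ zetaSpan s := by
  have hle : zetaSpan (5 * i + s) ≤ (zetaSpan s).map (LinearMap.mulLeft ℤ (tau ^ i)) := by
    refine Submodule.span_le.mpr ?_
    rintro _ ⟨j, hj, rfl⟩
    obtain ⟨k, rfl⟩ : ∃ k, j = i + k := Nat.exists_eq_add_of_le (by omega)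
    refine ⟨_, smul_tau_pow_mem_tauSpan (j := k) (by omega) dvd_rfl, ?_⟩
    rw [map_smul, LinearMap.mulLeft_apply, ← pow_add]
    congr 3
    omega
  obtain ⟨y, hy, hxy⟩ := hle h
  rwa [← mul_left_cancel₀ (pow_ne_zero i tau_ne_zero) hxy]

theorem section5_zero_tau_pow_mem (i : ℕ) : section5 0 (tau ^ i) ∈ zetaSpan i := by
  refine mem_zetaSpan_of_tau_pow_mul_mem (i := i) ?_
  rw [← section5_zero_dilate_mul, map_pow, ← mul_pow, dilate_tau_mul_tau, ← pow_mul,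
    show 6 * i = 5 * i + i by ring]
  exact section5_zero_zeta_pow_mem _

theorem section5_zero_zeta_mul_tau_pow_mem (i : ℕ) :
    section5 0 (zeta * tau ^ i) ∈ zetaSpan (i + 1) := by
  refine mem_zetaSpan_of_tau_pow_mul_mem (i := i) ?_
  rw [← section5_zero_dilate_mul, map_pow, mul_left_comm, ← mul_pow, dilate_tau_mul_tau,
    ← pow_mul, ← pow_succ', show 6 * i + 1 = 5 * i + (i + 1) by ring]
  exact section5_zero_zeta_pow_mem _

/-- A module containing the generating series at the odd steps. -/
noncomputable abbrev oddSpan (n : ℕ) : Submodule ℤ ℤ⟦X⟧ :=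
  tauSpan 1 fun j ↦ n + (5 * j - 5) / 2

/-- A module containing the generating series at the even steps. -/
noncomputable abbrev evenSpan (n : ℕ) : Submodule ℤ ℤ⟦X⟧ :=
  tauSpan 1 fun j ↦ n + (5 * j - 4) / 2

theorem section5_zero_mem_evenSpan {n : ℕ} {x : ℤ⟦X⟧} (hx : x ∈ oddSpan n) :
    section5 0 x ∈ evenSpan (n + 1) :=
  map_mem_of_mem_tauSpan hx (section5 0) _ fun j hj ↦
    smul_mem_tauSpan (section5_zero_tau_pow_mem j) fun k hk ↦ by
      obtain rfl | hj' := hj.eq_or_lt <;> omega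

theorem section5_zero_zeta_mul_mem_oddSpan {n : ℕ} {x : ℤ⟦X⟧} (hx : x ∈ evenSpan n) :
    section5 0 (zeta * x) ∈ oddSpan (n + 1) :=
  map_mem_of_mem_tauSpan hx (section5 0 ∘ₗ LinearMap.mulLeft ℤ zeta) _ fun j hj ↦
    smul_mem_tauSpan (section5_zero_zeta_mul_tau_pow_mem j) fun k hk ↦ by omega

theorem pow_dvd_coeff_mul {n l : ℕ} {e : ℕ → ℕ} {x : ℤ⟦X⟧} (hx : x ∈ tauSpan l e)
    (he : ∀ j, l ≤ j → n ≤ e j) (f : ℤ⟦X⟧) (k : ℕ) : 5 ^ n ∣ coeff k (x * f) := by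
  induction hx using Submodule.span_induction with
  | mem x h =>
    obtain ⟨j, hj, rfl⟩ := h
    rw [smul_mul_assoc, map_zsmul, smul_eq_mul]
    exact (pow_dvd_pow 5 (he j hj)).mul_right _
  | zero => simp
  | add x y _ _ hx hy =>
    rw [add_mul, map_add]
    exact dvd_add hx hy
  | smul a x _ hx =>
    rw [smul_mul_assoc, map_zsmul, smul_eq_mul]
    exact hx.mul_left _

/-- The generating series of the values `partp n` with `24 * n ≡ 1 [MOD 5 ^ (2 * i + 1)]`. -/
noncomputable def progressionSeries : ℕ → ℤ⟦X⟧
  | 0 => section5 0 (X * partSeries)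
  | i + 1 => section5 0 (X * section5 0 (progressionSeries i))

theorem section5_zero_progressionSeries_mul_euler (i : ℕ) :
    section5 0 (progressionSeries i) * euler =
      section5 0 (progressionSeries i * dilate euler) := by
  rw [mul_comm (progressionSeries i), section5_zero_dilate_mul, mul_comm]

theorem progressionSeries_mul_dilate_euler_mem (i : ℕ) :
    progressionSeries i * dilate euler ∈ oddSpan (2 * i + 1) := by
  induction i with
  | zero =>
    have h : progressionSeries 0 * dilate euler = section5 0 zeta := by
      rw [progressionSeries, mul_comm, ← section5_zero_dilate_mul, zeta]
      congr 1
      ring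
    rw [h, section5_zero_zeta, ← pow_one tau]
    exact smul_tau_pow_mem_tauSpan le_rfl (by norm_num)
  | succ i ih =>
    have h : progressionSeries (i + 1) * dilate euler =
        section5 0 (zeta * (section5 0 (progressionSeries i) * euler)) := by
      rw [progressionSeries, mul_comm, ← section5_zero_dilate_mul, zeta]
      congr 1
      linear_combination -X * dilate (dilate euler) * section5 0 (progressionSeries i) *
        euler_mul_partSeries
    rw [h, section5_zero_progressionSeries_mul_euler]
    exact section5_zero_zeta_mul_mem_oddSpan (section5_zero_mem_evenSpan ih)

theorem pow_dvd_coeff_progressionSeries (i k : ℕ) :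
    5 ^ (2 * i + 1) ∣ coeff k (progressionSeries i) := by
  have := pow_dvd_coeff_mul (progressionSeries_mul_dilate_euler_mem i) (n := 2 * i + 1)
    (fun j _ ↦ by omega) (dilate partSeries) k
  rwa [mul_assoc, dilate_euler_mul_dilate_partSeries, mul_one] at this

theorem pow_dvd_coeff_section5_zero_progressionSeries (i k : ℕ) :
    5 ^ (2 * i + 2) ∣ coeff k (section5 0 (progressionSeries i)) := by
  have h := section5_zero_mem_evenSpan (progressionSeries_mul_dilate_euler_mem i)
  rw [← section5_zero_progressionSeries_mul_euler] at h
  have := pow_dvd_coeff_mul h (n := 2 * i + 2) (fun j _ ↦ by omega) partSeries k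
  rwa [mul_assoc, euler_mul_partSeries, mul_one] at this

theorem coeff_section5_zero_X_mul (f : ℤ⟦X⟧) {k m : ℕ} (h : m + 1 = 5 * k) :
    coeff k (section5 0 (X * f)) = coeff m f := by
  rw [coeff_section5, add_zero, ← h, coeff_succ_X_mul]

theorem coeff_progressionSeries {i c n k : ℕ} (hc : 24 * c + 1 = 5 ^ (2 * i + 2))
    (h : n + c = 5 ^ (2 * i + 1) * k) : coeff k (progressionSeries i) = partp n := by
  induction i generalizing c k with
  | zero =>
    rw [progressionSeries, coeff_section5_zero_X_mul (m := n), partSeries, coeff_mk]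
    norm_num at hc h
    omega
  | succ i ih =>
    have hp : 5 ^ (2 * (i + 1) + 2) = 25 * 5 ^ (2 * i + 2) := by ring
    have hp1 : 5 ^ (2 * (i + 1) + 1) = 5 * 5 ^ (2 * i + 2) := by ring
    have hp2 : 5 ^ (2 * i + 2) = 5 * 5 ^ (2 * i + 1) := by ring
    rw [hp] at hc
    rw [hp1] at h
    obtain ⟨d, rfl⟩ : ∃ d, c = d + 5 ^ (2 * i + 2) :=
      Nat.exists_eq_add_of_le' (by omega)
    obtain ⟨k, rfl⟩ : ∃ l, k = l + 1 := Nat.exists_eq_succ_of_ne_zero (by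
      rintro rfl
      have : 0 < 5 ^ (2 * i + 2) := by positivity
      omega)
    rw [progressionSeries, coeff_section5_zero_X_mul (m := 5 * k + 4) _ (by ring),
      coeff_section5]
    refine ih (c := d) (by omega) ?_
    rw [hp2] at h
    linarith

theorem coeff_section5_zero_progressionSeries {i c n k : ℕ} (hc : 24 * c + 1 = 5 ^ (2 * i + 2))
    (h : n + c = 5 ^ (2 * i + 2) * k) :
    coeff k (section5 0 (progressionSeries i)) = partp n := by
  rw [coeff_section5]
  refine coeff_progressionSeries hc ?_
  rw [h]
  ring

theorem exists_mul_add_one_eq_pow (i : ℕ) : ∃ c, 24 * c + 1 = 5 ^ (2 * i + 2) := by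
  induction i with
  | zero => exact ⟨1, by norm_num⟩
  | succ i ih =>
    obtain ⟨c, hc⟩ := ih
    refine ⟨25 * c + 1, ?_⟩
    rw [show 5 ^ (2 * (i + 1) + 2) = 25 * 5 ^ (2 * i + 2) by ring, ← hc]
    ring

theorem pow_dvd_add {i j c n : ℕ} (hc : 24 * c + 1 = 5 ^ (2 * i + 2)) (hj : j ≤ 2 * i + 2)
    (h : 24 * n ≡ 1 [MOD 5 ^ j]) : 5 ^ j ∣ n + c := by
  have h24 : Nat.Coprime (5 ^ j) 24 := Nat.Coprime.pow_left j (by norm_num)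
  refine h24.dvd_of_dvd_mul_left ?_
  have h1 : 24 * n + 24 * c ≡ 1 + 24 * c [MOD 5 ^ j] := h.add_right _
  rw [add_comm 1, hc, ← mul_add] at h1
  exact (h1.dvd_iff dvd_rfl).mpr (pow_dvd_pow 5 hj)

end RamanujanWatson

theorem stmt5 (n j : ℕ) (hj : 1 ≤ j) (h : 24 * n ≡ 1 [MOD 5 ^ j]) :
    5 ^ j ∣ partp n := by
  obtain ⟨i, hi⟩ : ∃ i, j = 2 * i + 1 ∨ j = 2 * i + 2 := ⟨(j - 1) / 2, by omega⟩
  obtain ⟨c, hc⟩ := RamanujanWatson.exists_mul_add_one_eq_pow i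
  obtain ⟨k, hk⟩ := RamanujanWatson.pow_dvd_add hc (by omega) h
  zify
  rcases hi with rfl | rfl
  · rw [← RamanujanWatson.coeff_progressionSeries hc hk]
    exact RamanujanWatson.pow_dvd_coeff_progressionSeries i k
  · rw [← RamanujanWatson.coeff_section5_zero_progressionSeries hc hk]
    exact RamanujanWatson.pow_dvd_coeff_section5_zero_progressionSeries i k
end

section
/- If 24n ≡ 1 (mod 7^j) for some j ≥ 1, then p(n) ≡ 0 (mod 7^{⌊j/2⌋+1}), where p is the partition function. -/
namespace PartitionModSeven

open PowerSeries

/-- The Euler function `∏ (1 - X ^ n)`, in its pentagonal expansion. -/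
noncomputable abbrev euler : ℤ⟦X⟧ := pentagonalSeries ℤ

/-- The generating function of the partition numbers. -/
noncomputable def partitionSeries : ℤ⟦X⟧ := mk fun n => (Fintype.card (Nat.Partition n) : ℤ)

open scoped PowerSeries.WithPiTopology in
theorem partitionSeries_mul_euler : partitionSeries * euler = 1 := by
  let _ : TopologicalSpace ℤ := ⊥
  have _ : DiscreteTopology ℤ := ⟨rfl⟩
  have h1 := (Nat.Partition.hasProd_powerSeriesMk_card_restricted ℤ (fun _ => True)).mul
    (WithPiTopology.hasProd_one_sub_X_pow ℤ)
  have h2 : (PowerSeries.mk fun n => ((Nat.Partition.restricted n fun _ => True).card : ℤ))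
      = partitionSeries := by
    simp [partitionSeries, Nat.Partition.restricted, Finset.card_univ]
  rw [h2] at h1
  refine h1.unique ?_
  convert hasProd_one with i
  simp only [if_true, pow_mul]
  exact WithPiTopology.tsum_pow_mul_one_sub_of_constantCoeff_eq_zero (by simp)

/-- The finite Euler product `∏_{i = 1}^{n} (1 - X ^ i)`. -/
noncomputable def eulerProd (n : ℕ) : ℤ⟦X⟧ := ∏ i ∈ Finset.range n, (1 - X ^ (i + 1))

@[simp] theorem eulerProd_zero : eulerProd 0 = 1 := by simp [eulerProd]

theorem eulerProd_succ (n : ℕ) : eulerProd (n + 1) = eulerProd n * (1 - X ^ (n + 1)) := by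
  simp [eulerProd, Finset.prod_range_succ]

theorem isUnit_eulerProd (n : ℕ) : IsUnit (eulerProd n) := by
  rw [isUnit_iff_constantCoeff]
  simp [eulerProd, map_prod]

theorem X_pow_dvd_eulerProd_sub {r m : ℕ} (h : r ≤ m) :
    (X : ℤ⟦X⟧) ^ (r + 1) ∣ eulerProd m - eulerProd r := by
  induction m, h using Nat.le_induction with
  | base => simp
  | succ m hm ih =>
    have : eulerProd (m + 1) - eulerProd r
        = (eulerProd m - eulerProd r) - X ^ (m + 1) * eulerProd m := by
      rw [eulerProd_succ]; ring
    rw [this]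
    exact dvd_sub ih (Dvd.dvd.mul_right (pow_dvd_pow _ (by omega)) _)

theorem X_pow_dvd_euler_sub (r : ℕ) : (X : ℤ⟦X⟧) ^ (r + 1) ∣ euler - eulerProd r := by
  rw [X_pow_dvd_iff]
  intro m hm
  obtain ⟨N, hN⟩ := (Filter.tendsto_finset_range.eventually
    (coeff_prod_one_sub_X_pow_eventually_eq ℤ m)).exists_forall_of_atTop
  have h1 := hN (max N r) (le_max_left _ _)
  have h2 := (X_pow_dvd_iff.mp (X_pow_dvd_eulerProd_sub (le_max_right N r))) m hm
  rw [eulerProd, map_sub, h1] at h2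
  rw [map_sub, h2]

section GaussianBinomial

variable {R : Type*} [CommRing R]

/-- Gaussian binomial coefficients. -/
def gaussBinom (q : R) : ℕ → ℕ → R
  | _, 0 => 1
  | 0, _ + 1 => 0
  | n + 1, k + 1 => gaussBinom q n k + q ^ (k + 1) * gaussBinom q n (k + 1)

@[simp] theorem gaussBinom_zero_right (q : R) (n : ℕ) : gaussBinom q n 0 = 1 := by
  cases n <;> rfl

theorem gaussBinom_succ_succ (q : R) (n k : ℕ) : gaussBinom q (n + 1) (k + 1) =
    gaussBinom q n k + q ^ (k + 1) * gaussBinom q n (k + 1) := rfl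

theorem gaussBinom_eq_zero_of_lt (q : R) {n k : ℕ} (h : n < k) : gaussBinom q n k = 0 := by
  induction n generalizing k with
  | zero => obtain ⟨k, rfl⟩ := Nat.exists_eq_succ_of_ne_zero h.ne'; rfl
  | succ n ih =>
    obtain ⟨k, rfl⟩ := Nat.exists_eq_succ_of_ne_zero (by omega : k ≠ 0)
    rw [Nat.succ_eq_add_one, gaussBinom_succ_succ, ih (by omega), ih (by omega)]; simp

theorem map_gaussBinom {S : Type*} [CommRing S] (f : R →+* S) (q : R) (n k : ℕ) :
    f (gaussBinom q n k) = gaussBinom (f q) n k := by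
  induction n generalizing k with
  | zero => cases k <;> simp [gaussBinom]
  | succ n ih => cases k <;> simp [gaussBinom, ih]

/-- The finite `q`-binomial theorem. -/
theorem prod_add_mul_pow (q u v : R) (m : ℕ) :
    ∏ i ∈ Finset.range m, (u + v * q ^ i) =
      ∑ j ∈ Finset.range (m + 1),
        q ^ (j.choose 2) * gaussBinom q m j * u ^ (m - j) * v ^ j := by
  induction m generalizing v with
  | zero => simp
  | succ m ih =>
    rw [Finset.prod_range_succ']
    have h1 : ∀ i ∈ Finset.range m, u + v * q ^ (i + 1) = u + (v * q) * q ^ i := by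
      intros; ring
    rw [Finset.prod_congr rfl h1, ih, Finset.sum_range_succ' _ (m + 1), pow_zero, mul_one, mul_add]
    set f : ℕ → R := fun j => q ^ (j.choose 2) * gaussBinom q m j * u ^ (m - j) *
      (v * q) ^ j with hf
    have e1 : (∑ j ∈ Finset.range (m + 1), f j) * u
        = (∑ j ∈ Finset.range (m + 1), f (j + 1) * u) + f 0 * u := by
      have hm : f (m + 1) = 0 := by simp [hf, gaussBinom_eq_zero_of_lt q (Nat.lt_succ_self m)]
      rw [← Finset.sum_mul, ← add_mul, ← Finset.sum_range_succ' f, Finset.sum_range_succ f (m + 1),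
        hm, add_zero]
    have e2 : ∀ j ∈ Finset.range (m + 1), q ^ ((j + 1).choose 2) * gaussBinom q (m + 1) (j + 1) *
        u ^ (m + 1 - (j + 1)) * v ^ (j + 1) = f (j + 1) * u + f j * v := by
      intro j hj
      rw [Finset.mem_range] at hj
      have hc : (j + 1).choose 2 = j + j.choose 2 := by
        rw [Nat.choose_succ_succ' j 1]; simp
      rcases (Nat.lt_succ_iff_lt_or_eq.mp hj) with h | rfl
      · obtain ⟨l, rfl⟩ := Nat.exists_eq_add_of_lt h
        simp only [hf, gaussBinom_succ_succ, hc]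
        rw [show j + l + 1 + 1 - (j + 1) = l + 1 by omega, show j + l + 1 - (j + 1) = l by omega,
          show j + l + 1 - j = l + 1 by omega]
        ring
      · simp only [hf, gaussBinom_succ_succ, hc, gaussBinom_eq_zero_of_lt q (Nat.lt_succ_self j)]
        simp
        ring
    rw [e1, Finset.sum_congr rfl e2, Finset.sum_add_distrib, ← Finset.sum_mul,
      ← Finset.sum_mul]
    have hf0 : f 0 = u ^ m := by simp [hf]
    rw [hf0, Nat.choose_zero_succ, gaussBinom_zero_right, Nat.sub_zero]
    ring

end GaussianBinomial

theorem gaussBinom_mul_eulerProd (j l : ℕ) :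
    gaussBinom (X : ℤ⟦X⟧) (j + l) j * (eulerProd j * eulerProd l) = eulerProd (j + l) := by
  induction h : j + l generalizing j l with
  | zero =>
    obtain ⟨rfl, rfl⟩ : j = 0 ∧ l = 0 := by omega
    simp
  | succ m ih =>
    rcases j with _ | j
    · obtain rfl : l = m + 1 := by omega
      simp
    rcases l with _ | l
    · obtain rfl : j = m := by omega
      have := ih j 0 (by omega)
      rw [gaussBinom_succ_succ, gaussBinom_eq_zero_of_lt _ (Nat.lt_succ_self j)]
      simp only [eulerProd_succ, eulerProd_zero] at *
      linear_combination (1 - X ^ (j + 1)) * this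
    · obtain rfl : j + l + 1 = m := by omega
      have h1 := ih j (l + 1) (by omega)
      have h2 := ih (j + 1) l (by omega)
      rw [gaussBinom_succ_succ]
      rw [eulerProd_succ] at h1
      rw [eulerProd_succ] at h2
      rw [eulerProd_succ, eulerProd_succ, eulerProd_succ (j + l + 1)]
      linear_combination (1 - X ^ (j + 1)) * h1 + X ^ (j + 1) * (1 - X ^ (l + 1)) * h2

theorem two_mul_choose_two_add (n : ℕ) : 2 * n.choose 2 + n = n * n := by
  induction n with
  | zero => rfl
  | succ n ih =>
    have : (n + 1).choose 2 = n + n.choose 2 := by rw [Nat.choose_succ_succ' n 1]; simp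
    rw [this]; linarith

theorem prod_pow_sub_pow (n : ℕ) : ∏ i ∈ Finset.range n, ((X : ℤ⟦X⟧) ^ i - X ^ n) =
    X ^ n.choose 2 * eulerProd n := by
  have h1 : ∀ i ∈ Finset.range n, (X : ℤ⟦X⟧) ^ i - X ^ n = X ^ i * (1 - X ^ (n - 1 - i + 1)) := by
    intro i hi
    rw [Finset.mem_range] at hi
    rw [mul_sub, mul_one, ← pow_add]
    congr 2; omega
  rw [Finset.prod_congr rfl h1, Finset.prod_mul_distrib,
    Finset.prod_range_reflect (fun i => (1 : ℤ⟦X⟧) - X ^ (i + 1)), Finset.prod_pow_eq_pow_sum,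
    Finset.sum_range_id, ← Nat.choose_two_right, eulerProd]

theorem gaussBinom_symm (j l : ℕ) :
    gaussBinom (X : ℤ⟦X⟧) (j + l) j = gaussBinom X (j + l) l := by
  have h1 := gaussBinom_mul_eulerProd j l
  have h2 := gaussBinom_mul_eulerProd l j
  rw [add_comm l j, mul_comm (eulerProd l)] at h2
  exact mul_right_cancel₀ ((isUnit_eulerProd j).mul (isUnit_eulerProd l)).ne_zero (h1.trans h2.symm)

/-- A finite form of Jacobi's identity for the cube of the Euler function. -/
theorem eulerProd_sq (n : ℕ) : eulerProd n ^ 2 = ∑ k ∈ Finset.range (n + 1),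
    (-1) ^ k * (2 * (k : ℤ⟦X⟧) + 1) * X ^ (k + 1).choose 2 * gaussBinom X (2 * n + 1) (n - k) := by
  have h := congrArg (fun p => Polynomial.eval 1 (Polynomial.derivative p))
    (prod_add_mul_pow (Polynomial.C (X : ℤ⟦X⟧)) (Polynomial.C (-X ^ n)) Polynomial.X (2 * n + 1))
  simp only [← map_gaussBinom, ← map_pow, ← map_mul, Polynomial.derivative_sum,
    Polynomial.derivative_C_mul, Polynomial.derivative_X_pow, Polynomial.eval_finsetSum] at h
  rw [show 2 * n + 1 = n + (n + 1) by ring, Finset.prod_range_add, Finset.prod_range_succ',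
    ← mul_assoc, Polynomial.derivative_mul] at h
  simp only [Polynomial.derivative_add, Polynomial.derivative_mul, Polynomial.derivative_C,
    Polynomial.derivative_X, Polynomial.eval_add, Polynomial.eval_mul, Polynomial.eval_C,
    Polynomial.eval_X, Polynomial.eval_prod,
    Polynomial.eval_pow, add_zero, one_pow, mul_one, one_mul, mul_zero,
    zero_add, neg_add_cancel] at h
  have h1 : ∏ i ∈ Finset.range n, (-(X : ℤ⟦X⟧) ^ n + X ^ i) = X ^ n.choose 2 * eulerProd n := by
    rw [← prod_pow_sub_pow]; exact Finset.prod_congr rfl fun i _ => by ring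
  have h2 : ∏ i ∈ Finset.range n, (-(X : ℤ⟦X⟧) ^ n + X ^ (n + (i + 1))) =
      (-X ^ n) ^ n * eulerProd n := by
    have hc : (-(X : ℤ⟦X⟧) ^ n) ^ n = ∏ _i ∈ Finset.range n, (-(X : ℤ⟦X⟧) ^ n) := by simp
    rw [hc, eulerProd, ← Finset.prod_mul_distrib]
    exact Finset.prod_congr rfl fun i _ => by ring
  rw [h1, h2, show n + (n + 1) + 1 = (n + 1) + (n + 1) by ring, Finset.sum_range_add,
    ← Finset.sum_range_reflect, ← Finset.sum_add_distrib] at h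
  have h0 : (X : ℤ⟦X⟧) ^ n.choose 2 * (-X ^ n) ^ n * X ^ n ≠ 0 :=
    mul_ne_zero (mul_ne_zero (pow_ne_zero _ X_ne_zero) (pow_ne_zero _ (neg_ne_zero.mpr
      (pow_ne_zero _ X_ne_zero)))) (pow_ne_zero _ X_ne_zero)
  refine mul_left_cancel₀ h0 ?_
  rw [Finset.mul_sum]
  refine Eq.trans (by ring) (h.trans (Finset.sum_congr rfl fun k hk => ?_))
  rw [Finset.mem_range] at hk
  obtain ⟨l, rfl⟩ := Nat.exists_eq_add_of_le (Nat.lt_succ_iff.mp hk)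
  have s1 := gaussBinom_symm l (k + l + (1 + k))
  rw [show l + (k + l + (1 + k)) = 2 * (k + l) + 1 by ring] at s1
  have t1 := two_mul_choose_two_add l
  have t2 := two_mul_choose_two_add (k + l)
  have t3 := two_mul_choose_two_add (k + 1)
  have t4 := two_mul_choose_two_add (k + l + (1 + k))
  have x1 : l.choose 2 + (k + l) * (k + l + 1 + k) =
      (k + l).choose 2 + (k + l) * (k + l) + (k + l) + (k + 1).choose 2 := by
    refine Nat.eq_of_mul_eq_mul_left two_pos ?_
    linarith
  have x2 : (k + l + (1 + k)).choose 2 + (k + l) * l =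
      (k + l).choose 2 + (k + l) * (k + l) + (k + l) + (k + 1).choose 2 := by
    refine Nat.eq_of_mul_eq_mul_left two_pos ?_
    linarith
  rw [show k + l + 1 - 1 - k = l by omega, show k + l + 1 + k = k + l + (1 + k) by ring,
    show k + l + (k + l + 1) = 2 * (k + l) + 1 by ring, show k + l - k = l by omega,
    show 2 * (k + l) + 1 - l = k + l + 1 + k by omega,
    show 2 * (k + l) + 1 - (k + l + (1 + k)) = l by omega, ← s1]
  have y1 : (X : ℤ⟦X⟧) ^ l.choose 2 * (-X ^ (k + l)) ^ (k + l + 1 + k) =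
      (-1) ^ (k + l + 1 + k) * X ^ ((k + l).choose 2 + (k + l) * (k + l) + (k + l)
        + (k + 1).choose 2) := by
    rw [← x1, neg_pow, ← pow_mul, pow_add]; ring
  have y2 : (X : ℤ⟦X⟧) ^ (k + l + (1 + k)).choose 2 * (-X ^ (k + l)) ^ l =
      (-1) ^ l * X ^ ((k + l).choose 2 + (k + l) * (k + l) + (k + l) + (k + 1).choose 2) := by
    rw [← x2, neg_pow, ← pow_mul, pow_add]; ring
  have y3 : (X : ℤ⟦X⟧) ^ (k + l).choose 2 * (-X ^ (k + l)) ^ (k + l) * X ^ (k + l) *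
      X ^ (k + 1).choose 2 = (-1) ^ (k + l) *
        X ^ ((k + l).choose 2 + (k + l) * (k + l) + (k + l) + (k + 1).choose 2) := by
    rw [neg_pow, ← pow_mul]; ring
  have z1 : ((-1 : ℤ⟦X⟧)) ^ (k + l + 1 + k) = - (-1) ^ l := by
    rw [show k + l + 1 + k = l + 1 + (k + k) by ring, pow_add _ _ (k + k),
      Even.neg_one_pow ⟨k, rfl⟩]
    ring
  have z2 : ((-1 : ℤ⟦X⟧)) ^ (k + l) * (-1) ^ k = (-1) ^ l := by
    rw [add_comm, pow_add, mul_assoc, ← pow_add, Even.neg_one_pow ⟨k, rfl⟩, mul_one]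
  rw [z1] at y1
  push_cast
  linear_combination gaussBinom X (2 * (k + l) + 1) l * (l * y1 + (k + l + (1 + k)) * y2
    - (-1) ^ k * (2 * k + 1) * y3 - (2 * k + 1) * X ^ ((k + l).choose 2 + (k + l) * (k + l)
      + (k + l) + (k + 1).choose 2) * z2)

theorem X_pow_dvd_euler_mul_gaussBinom_sub (k l : ℕ) :
    (X : ℤ⟦X⟧) ^ (l + 1) ∣ euler * gaussBinom X (2 * (k + l) + 1) l - 1 := by
  have h := gaussBinom_mul_eulerProd l (2 * k + l + 1)
  rw [show l + (2 * k + l + 1) = 2 * (k + l) + 1 by ring] at h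
  refine ((isUnit_eulerProd l).mul (isUnit_eulerProd (2 * k + l + 1))).dvd_mul_left.mp ?_
  have e1 := X_pow_dvd_euler_sub l
  have e2 := X_pow_dvd_eulerProd_sub (show l ≤ 2 * k + l + 1 by omega)
  have e3 := X_pow_dvd_eulerProd_sub (show l ≤ 2 * (k + l) + 1 by omega)
  obtain ⟨f1, h1⟩ := e1
  obtain ⟨f2, h2⟩ := e2
  obtain ⟨f3, h3⟩ := e3
  refine ⟨f1 * eulerProd (2 * (k + l) + 1) + eulerProd l * f3 - eulerProd l * f2, ?_⟩
  linear_combination euler * h + eulerProd (2 * (k + l) + 1) * h1 + eulerProd l * h3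
    - eulerProd l * h2

/-- **Jacobi's identity** for the cube of the Euler function, coefficientwise. -/
theorem coeff_euler_cube (n : ℕ) : coeff n (euler ^ 3) = ∑ k ∈ Finset.range (n + 1),
    if n = (k + 1).choose 2 then (-1) ^ k * (2 * (k : ℤ) + 1) else 0 := by
  have h1 : (X : ℤ⟦X⟧) ^ (n + 1) ∣ euler ^ 3 - ∑ k ∈ Finset.range (n + 1),
      (-1) ^ k * (2 * (k : ℤ⟦X⟧) + 1) * X ^ (k + 1).choose 2 := by
    have e : euler ^ 3 - ∑ k ∈ Finset.range (n + 1),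
        (-1) ^ k * (2 * (k : ℤ⟦X⟧) + 1) * X ^ (k + 1).choose 2 =
        euler * (euler + eulerProd n) * (euler - eulerProd n) + ∑ k ∈ Finset.range (n + 1),
        (-1) ^ k * (2 * (k : ℤ⟦X⟧) + 1) * (X ^ (k + 1).choose 2 *
          (euler * gaussBinom X (2 * n + 1) (n - k) - 1)) := by
      have := congrArg (euler * ·) (eulerProd_sq n)
      simp only [Finset.mul_sum] at this
      simp only [mul_sub, Finset.sum_sub_distrib]
      simp only [mul_one, mul_assoc, mul_left_comm euler] at this ⊢
      linear_combination this
    rw [e]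
    refine dvd_add ((X_pow_dvd_euler_sub n).mul_left _) (Finset.dvd_sum fun k hk => ?_)
    rw [Finset.mem_range] at hk
    obtain ⟨l, rfl⟩ := Nat.exists_eq_add_of_le (Nat.lt_succ_iff.mp hk)
    rw [Nat.add_sub_cancel_left]
    refine Dvd.dvd.mul_left ?_ _
    refine (pow_dvd_pow _ ?_).trans ((pow_add (X : ℤ⟦X⟧) ((k + 1).choose 2) (l + 1)).symm ▸
      mul_dvd_mul_left _ (X_pow_dvd_euler_mul_gaussBinom_sub k l))
    have := two_mul_choose_two_add (k + 1)
    nlinarith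
  have h2 := X_pow_dvd_iff.mp h1 n (Nat.lt_succ_self n)
  rw [map_sub, sub_eq_zero] at h2
  rw [h2, map_sum]
  refine Finset.sum_congr rfl fun k _ => ?_
  have : (-1) ^ k * (2 * (k : ℤ⟦X⟧) + 1) = C ((-1) ^ k * (2 * (k : ℤ) + 1)) := by simp
  rw [this, coeff_C_mul_X_pow]

theorem strictMono_succ_choose_two : StrictMono fun k : ℕ => (k + 1).choose 2 := by
  refine strictMono_nat_of_lt_succ fun k => ?_
  have h1 := two_mul_choose_two_add (k + 1)
  have h2 := two_mul_choose_two_add (k + 1 + 1)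
  nlinarith

theorem coeff_euler_cube_choose (k : ℕ) :
    coeff ((k + 1).choose 2) (euler ^ 3) = (-1) ^ k * (2 * (k : ℤ) + 1) := by
  rw [coeff_euler_cube, Finset.sum_eq_single k]
  · simp
  · intro l _ hl
    exact if_neg fun h => hl (strictMono_succ_choose_two.injective h).symm
  · intro h
    exact absurd (Finset.mem_range_succ_iff.mpr strictMono_succ_choose_two.le_apply) h

theorem coeff_euler_cube_eq_zero {n : ℕ} (h : ∀ k : ℕ, n ≠ (k + 1).choose 2) :
    coeff n (euler ^ 3) = 0 := by
  rw [coeff_euler_cube]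
  exact Finset.sum_eq_zero fun k _ => if_neg (h k)

/-- The part of a power series supported on exponents congruent to `r` modulo `7`. -/
noncomputable def comp (r : ZMod 7) : ℤ⟦X⟧ →+ ℤ⟦X⟧ where
  toFun f := mk fun n => if (n : ZMod 7) = r then coeff n f else 0
  map_zero' := by ext n; simp
  map_add' f g := by ext n; simp only [coeff_mk, map_add]; split_ifs <;> simp

theorem coeff_comp (r : ZMod 7) (f : ℤ⟦X⟧) (n : ℕ) :
    coeff n (comp r f) = if (n : ZMod 7) = r then coeff n f else 0 := by
  simp [comp]

theorem comp_comp (r s : ZMod 7) (f : ℤ⟦X⟧) :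
    comp r (comp s f) = if r = s then comp s f else 0 := by
  ext n
  rw [coeff_comp, coeff_comp]
  split_ifs with h1 h2 h3 h3 <;> simp_all [coeff_comp]

theorem sum_comp (f : ℤ⟦X⟧) : ∑ s, comp s f = f := by
  ext n
  simp [map_sum, coeff_comp]

/-- A power series supported on exponents congruent to `s` modulo `7`. -/
def IsHomog (s : ZMod 7) (g : ℤ⟦X⟧) : Prop := comp s g = g

theorem isHomog_comp (s : ZMod 7) (f : ℤ⟦X⟧) : IsHomog s (comp s f) := by
  simp [IsHomog, comp_comp]

theorem isHomog_iff {s : ZMod 7} {g : ℤ⟦X⟧} :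
    IsHomog s g ↔ ∀ n : ℕ, (n : ZMod 7) ≠ s → coeff n g = 0 := by
  simp only [IsHomog, PowerSeries.ext_iff, coeff_comp]
  refine forall_congr' fun n => ?_
  split_ifs with h <;> simp [h, eq_comm]

theorem IsHomog.comp_mul {s : ZMod 7} {g : ℤ⟦X⟧} (hg : IsHomog s g) (r : ZMod 7) (f : ℤ⟦X⟧) :
    comp r (g * f) = g * comp (r - s) f := by
  ext n
  rw [coeff_comp, coeff_mul, coeff_mul,
    show ∀ (P : Prop) [Decidable P] (S : Finset (ℕ × ℕ)) (F : ℕ × ℕ → ℤ),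
      (if P then ∑ p ∈ S, F p else 0) = ∑ p ∈ S, if P then F p else 0 by
      intro P _ S F; split_ifs <;> simp]
  refine Finset.sum_congr rfl fun p hp => ?_
  by_cases h : (p.1 : ZMod 7) = s
  · have : (n : ZMod 7) = s + p.2 := by
      rw [← Finset.HasAntidiagonal.mem_antidiagonal.mp hp, Nat.cast_add, h]
    simp only [coeff_comp, this, eq_sub_iff_add_eq']
    split_ifs <;> simp
  · simp [isHomog_iff.mp hg _ h]

theorem comp_mul (r : ZMod 7) (f g : ℤ⟦X⟧) :
    comp r (f * g) = ∑ s, comp s f * comp (r - s) g := by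
  conv_lhs => rw [← sum_comp f, Finset.sum_mul, map_sum]
  exact Finset.sum_congr rfl fun s _ => (isHomog_comp s f).comp_mul r g

theorem IsHomog.mul {s t : ZMod 7} {f g : ℤ⟦X⟧} (hf : IsHomog s f) (hg : IsHomog t g) :
    IsHomog (s + t) (f * g) := by
  rw [IsHomog, hf.comp_mul, add_sub_cancel_left, hg]

theorem isHomog_one : IsHomog 0 (1 : ℤ⟦X⟧) := by
  rw [isHomog_iff]
  intro n hn
  rw [coeff_one, if_neg]
  rintro rfl
  simp at hn

theorem IsHomog.pow {s : ZMod 7} {f : ℤ⟦X⟧} (hf : IsHomog s f) (n : ℕ) :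
    IsHomog (n * s) (f ^ n) := by
  induction n with
  | zero => simpa using isHomog_one
  | succ n ih =>
    rw [pow_succ, Nat.cast_succ, add_mul, one_mul]
    exact ih.mul hf

theorem isHomog_X : IsHomog 1 (X : ℤ⟦X⟧) := by
  rw [isHomog_iff]
  intro n hn
  rw [coeff_X, if_neg]
  rintro rfl
  simp at hn

/-- The substitution `X ↦ X ^ 7`. -/
noncomputable abbrev expandSeven : ℤ⟦X⟧ →ₐ[ℤ] ℤ⟦X⟧ := expand 7 (by norm_num)

theorem isHomog_expandSeven (f : ℤ⟦X⟧) : IsHomog 0 (expandSeven f) := by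
  rw [isHomog_iff]
  intro n hn
  refine coeff_expand_of_not_dvd _ _ _ fun h => hn ?_
  rwa [ZMod.natCast_eq_zero_iff]

/-- The operator keeping every seventh coefficient. -/
noncomputable def atkin : ℤ⟦X⟧ →+ ℤ⟦X⟧ where
  toFun f := mk fun n => coeff (7 * n) f
  map_zero' := by ext n; simp
  map_add' f g := by ext n; simp

@[simp] theorem coeff_atkin (f : ℤ⟦X⟧) (n : ℕ) : coeff n (atkin f) = coeff (7 * n) f := by
  simp [atkin]

theorem expandSeven_atkin (f : ℤ⟦X⟧) : expandSeven (atkin f) = comp 0 f := by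
  ext n
  rw [coeff_expand, coeff_comp]
  simp only [ZMod.natCast_eq_zero_iff]
  split_ifs with h
  · rw [coeff_atkin, Nat.mul_div_cancel' h]
  · rfl

theorem atkin_expandSeven (f : ℤ⟦X⟧) : atkin (expandSeven f) = f := by
  ext n; simp

theorem expandSeven_injective : Function.Injective expandSeven :=
  Function.LeftInverse.injective atkin_expandSeven

theorem atkin_expandSeven_mul (f g : ℤ⟦X⟧) : atkin (expandSeven f * g) = f * atkin g := by
  apply expandSeven_injective
  rw [expandSeven_atkin, (isHomog_expandSeven f).comp_mul, sub_zero, map_mul expandSeven,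
    expandSeven_atkin]

theorem coeff_X_pow_mul_expand_expand (k n : ℕ) (f : ℤ⟦X⟧) :
    coeff n (X ^ k * expandSeven (expandSeven f)) =
      if k ≤ n ∧ 49 ∣ n - k then coeff ((n - k) / 49) f else 0 := by
  have : expandSeven (expandSeven f) = expand 49 (by norm_num) f := (expand_mul 7 _ 7 _ f).symm
  rw [this, coeff_X_pow_mul', coeff_expand]
  split_ifs <;> simp_all

theorem two_mul_pentagonal_zmod (k : ℤ) : 2 * (pentagonal k : ZMod 7) = k * (3 * k - 1) := by
  exact_mod_cast congrArg (Int.cast : ℤ → ZMod 7) (two_mul_natCast_pentagonal k)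

theorem pentagonal_seven_mul_sub_one (l : ℤ) : pentagonal (7 * l - 1) = 49 * pentagonal l + 2 := by
  have h1 := two_mul_natCast_pentagonal l
  have h2 := two_mul_natCast_pentagonal (7 * l - 1)
  zify
  linarith

theorem exists_eq_of_pentagonal_eq_two {k : ℤ} (h : (pentagonal k : ZMod 7) = 2) :
    ∃ l : ℤ, k = 7 * l - 1 := by
  have h1 := two_mul_pentagonal_zmod k
  rw [h] at h1
  have h2 : ∀ x : ZMod 7, 2 * 2 = x * (3 * x - 1) → x + 1 = 0 := by decide
  have h3 : ((k + 1 : ℤ) : ZMod 7) = 0 := by exact_mod_cast h2 _ h1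
  obtain ⟨l, hl⟩ := (ZMod.intCast_zmod_eq_zero_iff_dvd (k + 1) 7).mp h3
  exact ⟨l, by push_cast at hl; linarith⟩

theorem comp_two_euler : comp 2 euler = -(X ^ 2 * expandSeven (expandSeven euler)) := by
  ext n
  rw [coeff_comp, map_neg, coeff_X_pow_mul_expand_expand]
  split_ifs with h1 h2 h2
  · obtain ⟨h2, m, hm⟩ := h2
    obtain rfl : n = 49 * m + 2 := by omega
    rw [hm, Nat.mul_div_cancel_left _ (by norm_num)]
    by_cases hp : m ∈ Set.range pentagonal
    · obtain ⟨l, rfl⟩ := hp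
      rw [← pentagonal_seven_mul_sub_one, coeff_pentagonalSeries_pentagonal,
        coeff_pentagonalSeries_pentagonal]
      have : Odd (7 * l - 1) ↔ ¬ Odd l := by grind
      by_cases hl : Odd l
      · rw [Int.negOnePow_even _ (by grind), Int.negOnePow_odd _ hl]; simp
      · rw [Int.negOnePow_odd _ (by grind), Int.negOnePow_even _ (by grind)]; simp
    · rw [coeff_pentagonalSeries_eq_zero ℤ hp, coeff_pentagonalSeries_eq_zero, neg_zero]
      rintro ⟨k, hk⟩
      obtain ⟨l, rfl⟩ := exists_eq_of_pentagonal_eq_two (hk ▸ h1)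
      rw [pentagonal_seven_mul_sub_one] at hk
      exact hp ⟨l, by omega⟩
  · rw [neg_zero]
    refine coeff_pentagonalSeries_eq_zero ℤ ?_
    rintro ⟨k, rfl⟩
    obtain ⟨l, rfl⟩ := exists_eq_of_pentagonal_eq_two h1
    rw [pentagonal_seven_mul_sub_one] at h2
    exact h2 ⟨by omega, pentagonal l, by omega⟩
  · obtain ⟨h2, m, hm⟩ := h2
    obtain rfl : n = 49 * m + 2 := by omega
    refine absurd ?_ h1
    push_cast
    rw [show (49 : ZMod 7) = 0 from rfl, zero_mul, zero_add]
  · rfl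

theorem comp_euler_eq_zero {r : ZMod 7} (hr : ∀ x : ZMod 7, 2 * r ≠ x * (3 * x - 1)) :
    comp r euler = 0 := by
  ext n
  rw [coeff_comp, map_zero]
  split_ifs with h
  · refine coeff_pentagonalSeries_eq_zero ℤ ?_
    rintro ⟨k, rfl⟩
    exact hr k (h ▸ two_mul_pentagonal_zmod k)
  · rfl

theorem two_mul_succ_choose_two_zmod (k : ℕ) :
    2 * (((k + 1).choose 2 : ℕ) : ZMod 7) = k * (k + 1) := by
  have := congrArg (Nat.cast : ℕ → ZMod 7) (two_mul_choose_two_add (k + 1))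
  push_cast at this
  linear_combination this

theorem succ_choose_two_seven_mul_add_three (m : ℕ) :
    (7 * m + 3 + 1).choose 2 = 49 * (m + 1).choose 2 + 6 := by
  have h1 := two_mul_choose_two_add (m + 1)
  have h2 := two_mul_choose_two_add (7 * m + 3 + 1)
  linarith

theorem exists_eq_of_succ_choose_two_eq_six {k : ℕ} (h : (((k + 1).choose 2 : ℕ) : ZMod 7) = 6) :
    ∃ m : ℕ, k = 7 * m + 3 := by
  have h1 := two_mul_succ_choose_two_zmod k
  rw [h] at h1
  have h2 : ∀ x : ZMod 7, 2 * 6 = x * (x + 1) → x = (3 : ℕ) := by decide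
  have h3 := (ZMod.natCast_eq_natCast_iff' _ _ _).mp (h2 _ h1)
  exact ⟨k / 7, by omega⟩

theorem comp_six_euler_cube :
    comp 6 (euler ^ 3) = -7 * (X ^ 6 * expandSeven (expandSeven (euler ^ 3))) := by
  rw [← map_ofNat (C : ℤ →+* ℤ⟦X⟧) 7, ← map_neg]
  ext n
  rw [coeff_comp, coeff_C_mul, coeff_X_pow_mul_expand_expand]
  split_ifs with h1 h2 h2
  · obtain ⟨h2, m, hm⟩ := h2
    obtain rfl : n = 49 * m + 6 := by omega
    rw [hm, Nat.mul_div_cancel_left _ (by norm_num)]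
    by_cases hp : ∃ k : ℕ, m = (k + 1).choose 2
    · obtain ⟨k, rfl⟩ := hp
      rw [← succ_choose_two_seven_mul_add_three, coeff_euler_cube_choose,
        coeff_euler_cube_choose, pow_add, pow_mul]
      push_cast
      ring
    · push Not at hp
      rw [coeff_euler_cube_eq_zero hp, coeff_euler_cube_eq_zero, mul_zero]
      intro k hk
      obtain ⟨l, rfl⟩ := exists_eq_of_succ_choose_two_eq_six (hk ▸ h1)
      rw [succ_choose_two_seven_mul_add_three] at hk
      exact hp l (by omega)
  · rw [mul_zero]
    refine coeff_euler_cube_eq_zero ?_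
    rintro k rfl
    obtain ⟨l, rfl⟩ := exists_eq_of_succ_choose_two_eq_six h1
    rw [succ_choose_two_seven_mul_add_three] at h2
    exact h2 ⟨by omega, (l + 1).choose 2, by omega⟩
  · obtain ⟨h2, m, hm⟩ := h2
    obtain rfl : n = 49 * m + 6 := by omega
    refine absurd ?_ h1
    push_cast
    rw [show (49 : ZMod 7) = 0 from rfl, zero_mul, zero_add]
  · rw [mul_zero]

theorem comp_euler_cube_eq_zero {r : ZMod 7} (hr : ∀ x : ZMod 7, 2 * r ≠ x * (x + 1)) :
    comp r (euler ^ 3) = 0 := by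
  ext n
  rw [coeff_comp, map_zero]
  split_ifs with h
  · refine coeff_euler_cube_eq_zero ?_
    rintro k rfl
    exact hr k (h ▸ two_mul_succ_choose_two_zmod k)
  · rfl

theorem comp_zero_mul (f g : ℤ⟦X⟧) : comp 0 (f * g) =
      comp 0 f * comp 0 g + comp 1 f * comp 6 g + comp 2 f * comp 5 g +
      comp 3 f * comp 4 g + comp 4 f * comp 3 g + comp 5 f * comp 2 g + comp 6 f * comp 1 g :=
  (comp_mul 0 f g).trans (Fin.sum_univ_seven _)

theorem comp_one_mul (f g : ℤ⟦X⟧) : comp 1 (f * g) =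
      comp 0 f * comp 1 g + comp 1 f * comp 0 g + comp 2 f * comp 6 g +
      comp 3 f * comp 5 g + comp 4 f * comp 4 g + comp 5 f * comp 3 g + comp 6 f * comp 2 g :=
  (comp_mul 1 f g).trans (Fin.sum_univ_seven _)

theorem comp_two_mul (f g : ℤ⟦X⟧) : comp 2 (f * g) =
      comp 0 f * comp 2 g + comp 1 f * comp 1 g + comp 2 f * comp 0 g +
      comp 3 f * comp 6 g + comp 4 f * comp 5 g + comp 5 f * comp 4 g + comp 6 f * comp 3 g :=
  (comp_mul 2 f g).trans (Fin.sum_univ_seven _)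

theorem comp_three_mul (f g : ℤ⟦X⟧) : comp 3 (f * g) =
      comp 0 f * comp 3 g + comp 1 f * comp 2 g + comp 2 f * comp 1 g +
      comp 3 f * comp 0 g + comp 4 f * comp 6 g + comp 5 f * comp 5 g + comp 6 f * comp 4 g :=
  (comp_mul 3 f g).trans (Fin.sum_univ_seven _)

theorem comp_four_mul (f g : ℤ⟦X⟧) : comp 4 (f * g) =
      comp 0 f * comp 4 g + comp 1 f * comp 3 g + comp 2 f * comp 2 g +
      comp 3 f * comp 1 g + comp 4 f * comp 0 g + comp 5 f * comp 6 g + comp 6 f * comp 5 g :=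
  (comp_mul 4 f g).trans (Fin.sum_univ_seven _)

theorem comp_five_mul (f g : ℤ⟦X⟧) : comp 5 (f * g) =
      comp 0 f * comp 5 g + comp 1 f * comp 4 g + comp 2 f * comp 3 g +
      comp 3 f * comp 2 g + comp 4 f * comp 1 g + comp 5 f * comp 0 g + comp 6 f * comp 6 g :=
  (comp_mul 5 f g).trans (Fin.sum_univ_seven _)

theorem comp_six_mul (f g : ℤ⟦X⟧) : comp 6 (f * g) =
      comp 0 f * comp 6 g + comp 1 f * comp 5 g + comp 2 f * comp 4 g +
      comp 3 f * comp 3 g + comp 4 f * comp 2 g + comp 5 f * comp 1 g + comp 6 f * comp 0 g :=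
  (comp_mul 6 f g).trans (Fin.sum_univ_seven _)

/-- The component of the Euler function in the class of `5` modulo `7`. -/
noncomputable abbrev partA : ℤ⟦X⟧ := comp 5 euler

/-- The component of the Euler function in the class of `1` modulo `7`. -/
noncomputable abbrev partB : ℤ⟦X⟧ := comp 1 euler

/-- The component of the Euler function in the class of `0` modulo `7`. -/
noncomputable abbrev partC : ℤ⟦X⟧ := comp 0 euler

/-- The series `X ^ 2 * ∏ (1 - X ^ (49 * n))`, the negative of the component of the Euler
function in the class of `2` modulo `7`. -/
noncomputable def partD : ℤ⟦X⟧ := X ^ 2 * expandSeven (expandSeven euler)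

theorem comp_two_euler_eq_neg_partD : comp 2 euler = -partD := comp_two_euler

theorem comp_three_euler : comp 3 euler = 0 := comp_euler_eq_zero (by decide)

theorem comp_four_euler : comp 4 euler = 0 := comp_euler_eq_zero (by decide)

theorem comp_six_euler : comp 6 euler = 0 := comp_euler_eq_zero (by decide)

theorem euler_eq_parts : euler = partA + partB + partC - partD := by
  have h : ∑ s : ZMod 7, comp s euler = comp 0 euler + comp 1 euler + comp 2 euler +
      comp 3 euler + comp 4 euler + comp 5 euler + comp 6 euler :=
    Fin.sum_univ_seven (fun s : ZMod 7 => comp s euler)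
  rw [sum_comp, comp_two_euler_eq_neg_partD, comp_three_euler,
    comp_four_euler, comp_six_euler] at h
  linear_combination h

theorem comp_zero_euler_sq : comp 0 (euler ^ 2) = -2 * partA * partD + partC ^ 2 := by
  rw [sq euler, comp_zero_mul, comp_two_euler_eq_neg_partD, comp_three_euler,
    comp_four_euler, comp_six_euler]
  ring

theorem comp_one_euler_sq : comp 1 (euler ^ 2) = 2 * partB * partC := by
  rw [sq euler, comp_one_mul, comp_two_euler_eq_neg_partD, comp_three_euler,
    comp_four_euler, comp_six_euler]
  ring

theorem comp_two_euler_sq : comp 2 (euler ^ 2) = partB ^ 2 - 2 * partC * partD := by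
  rw [sq euler, comp_two_mul, comp_two_euler_eq_neg_partD, comp_three_euler,
    comp_four_euler, comp_six_euler]
  ring

theorem comp_three_euler_sq : comp 3 (euler ^ 2) = partA ^ 2 - 2 * partB * partD := by
  rw [sq euler, comp_three_mul, comp_two_euler_eq_neg_partD, comp_three_euler,
    comp_four_euler, comp_six_euler]
  ring

theorem comp_four_euler_sq : comp 4 (euler ^ 2) = partD ^ 2 := by
  rw [sq euler, comp_four_mul, comp_two_euler_eq_neg_partD, comp_three_euler,
    comp_four_euler, comp_six_euler]
  ring

theorem comp_five_euler_sq : comp 5 (euler ^ 2) = 2 * partA * partC := by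
  rw [sq euler, comp_five_mul, comp_two_euler_eq_neg_partD, comp_three_euler,
    comp_four_euler, comp_six_euler]
  ring

theorem comp_six_euler_sq : comp 6 (euler ^ 2) = 2 * partA * partB := by
  rw [sq euler, comp_six_mul, comp_two_euler_eq_neg_partD, comp_three_euler,
    comp_four_euler, comp_six_euler]
  ring

theorem comp_zero_euler_cube_eq : comp 0 (euler ^ 3) =
    3 * partA * partB ^ 2 - 6 * partA * partC * partD + partC ^ 3 := by
  rw [pow_succ' euler, comp_zero_mul, comp_two_euler_eq_neg_partD, comp_three_euler,
    comp_four_euler, comp_six_euler,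
    comp_zero_euler_sq, comp_one_euler_sq, comp_two_euler_sq,
    comp_three_euler_sq, comp_four_euler_sq, comp_five_euler_sq, comp_six_euler_sq]
  ring

theorem comp_one_euler_cube_eq : comp 1 (euler ^ 3) =
    partA ^ 3 - 6 * partA * partB * partD + 3 * partB * partC ^ 2 := by
  rw [pow_succ' euler, comp_one_mul, comp_two_euler_eq_neg_partD, comp_three_euler,
    comp_four_euler, comp_six_euler,
    comp_zero_euler_sq, comp_one_euler_sq, comp_two_euler_sq,
    comp_three_euler_sq, comp_four_euler_sq, comp_five_euler_sq, comp_six_euler_sq]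
  ring

theorem comp_two_euler_cube_eq : comp 2 (euler ^ 3) =
    3 * partA * partD ^ 2 + 3 * partB ^ 2 * partC - 3 * partC ^ 2 * partD := by
  rw [pow_succ' euler, comp_two_mul, comp_two_euler_eq_neg_partD, comp_three_euler,
    comp_four_euler, comp_six_euler,
    comp_zero_euler_sq, comp_one_euler_sq, comp_two_euler_sq,
    comp_three_euler_sq, comp_four_euler_sq, comp_five_euler_sq, comp_six_euler_sq]
  ring

theorem comp_three_euler_cube_eq : comp 3 (euler ^ 3) =
    3 * partA ^ 2 * partC + partB ^ 3 - 6 * partB * partC * partD := by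
  rw [pow_succ' euler, comp_three_mul, comp_two_euler_eq_neg_partD, comp_three_euler,
    comp_four_euler, comp_six_euler,
    comp_zero_euler_sq, comp_one_euler_sq, comp_two_euler_sq,
    comp_three_euler_sq, comp_four_euler_sq, comp_five_euler_sq, comp_six_euler_sq]
  ring

theorem comp_four_euler_cube_eq : comp 4 (euler ^ 3) =
    3 * partA ^ 2 * partB - 3 * partB ^ 2 * partD + 3 * partC * partD ^ 2 := by
  rw [pow_succ' euler, comp_four_mul, comp_two_euler_eq_neg_partD, comp_three_euler,
    comp_four_euler, comp_six_euler,
    comp_zero_euler_sq, comp_one_euler_sq, comp_two_euler_sq,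
    comp_three_euler_sq, comp_four_euler_sq, comp_five_euler_sq, comp_six_euler_sq]
  ring

theorem comp_five_euler_cube_eq : comp 5 (euler ^ 3) =
    -3 * partA ^ 2 * partD + 3 * partA * partC ^ 2 + 3 * partB * partD ^ 2 := by
  rw [pow_succ' euler, comp_five_mul, comp_two_euler_eq_neg_partD, comp_three_euler,
    comp_four_euler, comp_six_euler,
    comp_zero_euler_sq, comp_one_euler_sq, comp_two_euler_sq,
    comp_three_euler_sq, comp_four_euler_sq, comp_five_euler_sq, comp_six_euler_sq]
  ring

theorem comp_six_euler_cube_eq : comp 6 (euler ^ 3) =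
    6 * partA * partB * partC - partD ^ 3 := by
  rw [pow_succ' euler, comp_six_mul, comp_two_euler_eq_neg_partD, comp_three_euler,
    comp_four_euler, comp_six_euler,
    comp_zero_euler_sq, comp_one_euler_sq, comp_two_euler_sq,
    comp_three_euler_sq, comp_four_euler_sq, comp_five_euler_sq, comp_six_euler_sq]
  ring

theorem comp_six_euler_cube_eq_partD : comp 6 (euler ^ 3) = -7 * partD ^ 3 := by
  rw [comp_six_euler_cube, partD, mul_pow, map_pow, map_pow]
  ring

instance : CharZero ℤ⟦X⟧ :=
  charZero_of_injective_ringHom (f := (C : ℤ →+* ℤ⟦X⟧)) C_injective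

theorem mul_left_cancel_three {f : ℤ⟦X⟧} (h : 3 * f = 0) : f = 0 := by
  have h3 : (3 : ℤ⟦X⟧) ≠ 0 := by norm_num
  exact (mul_eq_zero.mp h).resolve_left h3

theorem partA_mul_partB_mul_partC : partA * partB * partC + partD ^ 3 = 0 := by
  have h : (6 : ℤ⟦X⟧) ≠ 0 := by norm_num
  refine (mul_eq_zero.mp ?_).resolve_left h
  linear_combination comp_six_euler_cube_eq_partD - comp_six_euler_cube_eq

theorem relation_two : partA * partD ^ 2 + partB ^ 2 * partC - partC ^ 2 * partD = 0 := by
  have h : comp 2 (euler ^ 3) = 0 := comp_euler_cube_eq_zero (by decide)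
  refine mul_left_cancel_three ?_
  linear_combination h - comp_two_euler_cube_eq

theorem relation_five : -partA ^ 2 * partD + partA * partC ^ 2 + partB * partD ^ 2 = 0 := by
  have h : comp 5 (euler ^ 3) = 0 := comp_euler_cube_eq_zero (by decide)
  refine mul_left_cancel_three ?_
  linear_combination h - comp_five_euler_cube_eq

theorem relation_four : partA ^ 2 * partB - partB ^ 2 * partD + partC * partD ^ 2 = 0 := by
  have h : comp 4 (euler ^ 3) = 0 := comp_euler_cube_eq_zero (by decide)
  refine mul_left_cancel_three ?_
  linear_combination h - comp_four_euler_cube_eq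

/-- The series `X * (∏ (1 - X ^ (7 * n))) ^ 4`, as a polynomial in the components of the Euler
function. -/
noncomputable def seriesW : ℤ⟦X⟧ :=
  -partA ^ 3 * partC - partA * partB ^ 3 - partB * partC ^ 3 - 8 * partD ^ 4

theorem comp_one_euler_pow_four : comp 1 (euler ^ 4) = -4 * seriesW - 7 * partD ^ 4 := by
  rw [show euler ^ 4 = euler ^ 2 * euler ^ 2 by ring, comp_one_mul,
    comp_zero_euler_sq, comp_one_euler_sq, comp_two_euler_sq,
    comp_three_euler_sq, comp_four_euler_sq, comp_five_euler_sq, comp_six_euler_sq,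
    seriesW]
  linear_combination (-24 * partD) * partA_mul_partB_mul_partC

theorem comp_three_euler_pow_five :
    comp 3 (euler ^ 5) = 10 * seriesW * partD + 49 * partD ^ 5 := by
  rw [show euler ^ 5 = euler ^ 3 * euler ^ 2 by ring, comp_three_mul,
    comp_zero_euler_sq, comp_one_euler_sq, comp_two_euler_sq,
    comp_three_euler_sq, comp_four_euler_sq, comp_five_euler_sq, comp_six_euler_sq,
    comp_zero_euler_cube_eq, comp_one_euler_cube_eq, comp_two_euler_cube_eq,
    comp_three_euler_cube_eq, comp_four_euler_cube_eq, comp_five_euler_cube_eq,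
    comp_six_euler_cube_eq, seriesW]
  linear_combination (30 * partD ^ 2) * partA_mul_partB_mul_partC +
    (10 * partB * partC) * relation_two +
    (10 * partA * partC) * relation_five +
    (10 * partA * partB) * relation_four

theorem comp_five_euler_pow_six : comp 5 (euler ^ 6) = 49 * partD ^ 6 := by
  have h2 : comp 2 (euler ^ 3) = 0 := comp_euler_cube_eq_zero (by decide)
  have h4 : comp 4 (euler ^ 3) = 0 := comp_euler_cube_eq_zero (by decide)
  have h5 : comp 5 (euler ^ 3) = 0 := comp_euler_cube_eq_zero (by decide)
  rw [show euler ^ 6 = euler ^ 3 * euler ^ 3 by ring, comp_five_mul, h2, h4, h5,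
    comp_six_euler_cube_eq_partD]
  ring

theorem modular_equation_parts (a b c d : ℤ⟦X⟧) (h1 : a * b * c + d ^ 3 = 0)
    (h2 : a * d ^ 2 + b ^ 2 * c - c ^ 2 * d = 0)
    (h3 : -a ^ 2 * d + a * c ^ 2 + b * d ^ 2 = 0)
    (h4 : a ^ 2 * b - b ^ 2 * d + c * d ^ 2 = 0) :
    (-a ^ 3 * c - a * b ^ 3 - b * c ^ 3 - 8 * d ^ 4) ^ 2 =
      (7 * (a + b + c - d) ^ 3 + 35 * (a + b + c - d) ^ 2 * d + 49 * (a + b + c - d) * d ^ 2) * d *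
        (-a ^ 3 * c - a * b ^ 3 - b * c ^ 3 - 8 * d ^ 4) +
      d * ((a + b + c - d) ^ 7 + 7 * (a + b + c - d) ^ 6 * d + 21 * (a + b + c - d) ^ 5 * d ^ 2 +
        49 * (a + b + c - d) ^ 4 * d ^ 3 + 147 * (a + b + c - d) ^ 3 * d ^ 4 +
        343 * (a + b + c - d) ^ 2 * d ^ 5 + 343 * (a + b + c - d) * d ^ 6) := by
  linear_combination
    (-7 * a ^ 4 * c - 21 * a ^ 4 * d + 3 * a ^ 3 * b ^ 2 - 35 * a ^ 3 * b * c - 84 *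
      a ^ 3 * b * d - 64 * a ^ 3 * c * d + 28 * a ^ 3 * d ^ 2 + 7 * a ^ 2 * b ^ 3 - 28
      * a ^ 2 * b ^ 2 * c - 112 * a ^ 2 * b ^ 2 * d - 28 * a ^ 2 * b * c ^ 2 - 203 * a
      ^ 2 * b * c * d + 7 * a ^ 2 * b * d ^ 2 + 2 * a ^ 2 * c ^ 3 - 112 * a ^ 2 * c ^
      2 * d + 28 * a ^ 2 * c * d ^ 2 + 35 * a ^ 2 * d ^ 3 + 7 * a * b ^ 4 - 14 * a * b
      ^ 3 * c - 60 * a * b ^ 3 * d - 196 * a * b ^ 2 * c * d - 21 * a * b * c ^ 3 -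
      196 * a * b * c ^ 2 * d - 6 * a * b * c * d ^ 2 + 56 * a * b * d ^ 3 - 84 * a *
      c ^ 3 * d + 14 * a * c ^ 2 * d ^ 2 + 56 * a * c * d ^ 3 + 35 * a * d ^ 4 - 14 *
      b ^ 4 * d + 2 * b ^ 3 * c ^ 2 - 84 * b ^ 3 * c * d - 112 * b ^ 2 * c ^ 2 * d + 7
      * b ^ 2 * c * d ^ 2 + 42 * b ^ 2 * d ^ 3 - 7 * b * c ^ 4 - 64 * b * c ^ 3 * d +
      28 * b * c ^ 2 * d ^ 2 + 84 * b * c * d ^ 3 + 28 * b * d ^ 4 - 21 * c ^ 4 * d +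
      28 * c ^ 3 * d ^ 2 + 35 * c ^ 2 * d ^ 3 + 28 * c * d ^ 4 + 9 * d ^ 5) * h1 +
    (-a ^ 4 * b + 14 * a ^ 4 * c - 7 * a ^ 3 * b ^ 2 + 28 * a ^ 3 * c ^ 2 + 7 * a ^ 3
      * c * d + 7 * a ^ 3 * d ^ 2 - 7 * a ^ 2 * b ^ 3 - 3 * a ^ 2 * b ^ 2 * d + 28 * a
      ^ 2 * b * d ^ 2 + 21 * a ^ 2 * c ^ 3 + 7 * a ^ 2 * c ^ 2 * d + 3 * a ^ 2 * c * d
      ^ 2 - 28 * a ^ 2 * d ^ 3 - 7 * a * b ^ 3 * d + 28 * a * b ^ 2 * d ^ 2 - 7 * a *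
      b * d ^ 3 + 7 * a * c ^ 4 + a * c ^ 3 * d - 28 * a * c * d ^ 3 + 7 * a * d ^ 4 -
      7 * b ^ 4 * d - 21 * b ^ 3 * c * d - b ^ 3 * d ^ 2 - 28 * b ^ 2 * c ^ 2 * d - 7
      * b ^ 2 * c * d ^ 2 - 14 * b * c ^ 3 * d - 7 * b * c ^ 2 * d ^ 2 - 3 * b * c * d
      ^ 3 + 28 * b * d ^ 4 + c ^ 5 - 7 * c ^ 2 * d ^ 3 + 28 * c * d ^ 4 - 7 * d ^ 5) * h2 +
    (a ^ 5 + 7 * a ^ 4 * b + 21 * a ^ 3 * b ^ 2 + 28 * a ^ 2 * b ^ 3 + 14 * a * b ^ 4) * h3 +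
    (b ^ 5) * h4

theorem seriesW_sq : seriesW ^ 2 =
    (7 * euler ^ 3 + 35 * euler ^ 2 * partD + 49 * euler * partD ^ 2) * partD * seriesW +
      partD * (euler ^ 7 + 7 * euler ^ 6 * partD + 21 * euler ^ 5 * partD ^ 2 +
        49 * euler ^ 4 * partD ^ 3 + 147 * euler ^ 3 * partD ^ 4 + 343 * euler ^ 2 * partD ^ 5 +
        343 * euler * partD ^ 6) := by
  have h := modular_equation_parts partA partB partC partD partA_mul_partB_mul_partC relation_two
    relation_five relation_four
  rw [← euler_eq_parts] at h
  exact h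

section Norm

variable {R : Type*} [CommRing R]

/-- The product of `c + ζ * b + ζ ^ 5 * a - ζ ^ 2 * d` over all seventh roots of unity `ζ`. -/
def rootNorm (a b c d : R) : R :=
  a ^ 7 + 7 * a ^ 5 * b * d + 7 * a ^ 4 * b * c ^ 2 + 14 * a ^ 3 * b ^ 2 * d ^ 2 +
    7 * a ^ 3 * c * d ^ 3 + 7 * a ^ 2 * b ^ 4 * c + 7 * a ^ 2 * b ^ 2 * c ^ 2 * d +
    14 * a ^ 2 * c ^ 3 * d ^ 2 + 7 * a * b ^ 3 * d ^ 3 + 7 * a * b ^ 2 * c ^ 4 +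
    14 * a * b * c * d ^ 4 + 7 * a * c ^ 5 * d + b ^ 7 + 7 * b ^ 5 * c * d +
    14 * b ^ 3 * c ^ 2 * d ^ 2 + 7 * b * c ^ 3 * d ^ 3 + c ^ 7 - d ^ 7

theorem map_rootNorm {S : Type*} [CommRing S] (f : R →+* S) (a b c d : R) :
    f (rootNorm a b c d) = rootNorm (f a) (f b) (f c) (f d) := by
  simp only [rootNorm, map_add, map_sub, map_mul, map_pow, map_ofNat]

/-- The rational part of the product of `c + ζ * b + ζ ^ 5 * a - ζ ^ 2 * d` over
`ζ = η, η ^ 2, η ^ 4`, where `η` is a primitive seventh root of unity. -/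
def halfNormRe (a b c d : R) : R :=
  a ^ 3 - a ^ 2 * b + 3 * a * b * c + a * b * d - a * c ^ 2 + a * c * d - a * d ^ 2 + b ^ 3 -
    b ^ 2 * c + b * c * d - b * d ^ 2 + c ^ 3 - c * d ^ 2 - d ^ 3

/-- The coefficient of `η + η ^ 2 + η ^ 4` in the product of `c + ζ * b + ζ ^ 5 * a - ζ ^ 2 * d`
over `ζ = η, η ^ 2, η ^ 4`, where `η` is a primitive seventh root of unity. -/
def halfNormIm (a b c d : R) : R :=
  -a ^ 2 * b + a ^ 2 * c - a ^ 2 * d + a * b ^ 2 + a * b * c - a * c ^ 2 - a * d ^ 2 -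
    b ^ 2 * c - b ^ 2 * d + b * c ^ 2 - b * d ^ 2 - c ^ 2 * d - c * d ^ 2

variable {η : R}

theorem mul_conjugates_one_two_four (h : 1 + η + η ^ 2 + η ^ 3 + η ^ 4 + η ^ 5 + η ^ 6 = 0)
    (a b c d : R) :
    (c + η * b + η ^ 5 * a - η ^ 2 * d) * (c + η ^ 2 * b + η ^ 3 * a - η ^ 4 * d) *
        (c + η ^ 4 * b + η ^ 6 * a - η * d) =
      halfNormRe a b c d + halfNormIm a b c d * (η + η ^ 2 + η ^ 4) := by
  simp only [halfNormRe, halfNormIm]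
  linear_combination
    (a ^ 3 * η ^ 8 - a ^ 3 * η ^ 7 + a ^ 3 * η - a ^ 3 + a ^ 2 * b * η ^ 7 - a ^ 2 *
      b * η ^ 5 + a ^ 2 * b * η ^ 4 - a ^ 2 * b * η ^ 3 + a ^ 2 * b + a ^ 2 * c * η ^
      5 - a ^ 2 * c * η ^ 4 + a ^ 2 * c * η ^ 3 - a ^ 2 * c * η - a ^ 2 * d * η ^ 9 +
      a ^ 2 * d * η ^ 8 - a ^ 2 * d * η ^ 5 + a ^ 2 * d * η ^ 4 - a ^ 2 * d * η ^ 3 +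
      a ^ 2 * d * η + a * b ^ 2 * η ^ 5 - a * b ^ 2 * η ^ 4 + a * b ^ 2 * η ^ 3 - a *
      b ^ 2 * η + a * b * c * η ^ 3 + 2 * a * b * c * η - 3 * a * b * c - a * b * d *
      η ^ 7 + a * b * d * η ^ 6 - a * b * d * η ^ 5 + a * b * d * η - a * b * d + a *
      c ^ 2 - a * c * d * η ^ 4 + a * c * d * η - a * c * d + a * d ^ 2 * η ^ 6 - a *
      d ^ 2 * η ^ 5 + a * d ^ 2 * η ^ 4 - a * d ^ 2 * η ^ 3 + a * d ^ 2 + b ^ 3 * η -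
      b ^ 3 + b ^ 2 * c - b ^ 2 * d * η ^ 3 + b ^ 2 * d * η - b * c * d * η ^ 2 + b *
      c * d * η - b * c * d + b * d ^ 2 * η ^ 4 - b * d ^ 2 * η ^ 3 + b * d ^ 2 + c *
      d ^ 2 - d ^ 3 * η + d ^ 3) * h

theorem prod_conjugates (h : 1 + η + η ^ 2 + η ^ 3 + η ^ 4 + η ^ 5 + η ^ 6 = 0) (a b c d : R) :
    ∏ k ∈ Finset.range 7, (c + η ^ k * b + η ^ (5 * k) * a - η ^ (2 * k) * d) =
      rootNorm a b c d := by
  have h7 : η ^ 7 = 1 := by linear_combination (η - 1) * h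
  have e (m r : ℕ) : η ^ (7 * m + r) = η ^ r := by rw [pow_add, pow_mul, h7, one_pow, one_mul]
  have h1 := mul_conjugates_one_two_four h a b c d
  have h3 := mul_conjugates_one_two_four (η := η ^ 3) (by
    simp only [← pow_mul, Nat.reduceMul]
    rw [e 0 6, e 1 2, e 1 5, e 2 1, e 2 4]
    linear_combination h) a b c d
  simp only [← pow_mul, Nat.reduceMul] at h3
  rw [e 0 6, e 1 2, e 1 5, e 2 1, e 2 4] at h3
  simp only [Finset.prod_range_succ, Finset.prod_range_zero, Nat.reduceMul]
  rw [e 1 1, e 1 3, e 1 5, e 2 1, e 2 6, e 3 4, e 4 2, pow_zero, pow_one]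
  rw [pow_one] at h3
  have hs : (η + η ^ 2 + η ^ 4) + (η ^ 3 + η ^ 6 + η ^ 5) = -1 := by linear_combination h
  have hs' : (η + η ^ 2 + η ^ 4) * (η ^ 3 + η ^ 6 + η ^ 5) = 2 := by
    linear_combination ((3 + η + η ^ 2 + η ^ 3) * (η - 1) + 1) * h
  generalize η + η ^ 2 + η ^ 4 = s at h1 hs hs'
  generalize η ^ 3 + η ^ 6 + η ^ 5 = s' at h3 hs hs'
  have regroup (x₀ x₁ x₂ x₃ x₄ x₅ x₆ : R) :
      1 * x₀ * x₁ * x₂ * x₃ * x₄ * x₅ * x₆ = x₀ * (x₁ * x₂ * x₄) * (x₃ * x₆ * x₅) := by ring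
  rw [regroup, h1, h3]
  calc
    _ = (a + b + c - d) * (halfNormRe a b c d ^ 2 -
        halfNormRe a b c d * halfNormIm a b c d + 2 * halfNormIm a b c d ^ 2) := by
      linear_combination (a + b + c - d) * halfNormRe a b c d * halfNormIm a b c d * hs +
        (a + b + c - d) * halfNormIm a b c d ^ 2 * hs'
    _ = rootNorm a b c d := by
      simp only [rootNorm, halfNormRe, halfNormIm]
      ring

theorem prod_one_sub_pow_mul (h : 1 + η + η ^ 2 + η ^ 3 + η ^ 4 + η ^ 5 + η ^ 6 = 0) (y : R) :
    ∏ k ∈ Finset.range 7, (1 - η ^ k * y) = 1 - y ^ 7 := by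
  have := prod_conjugates h 0 (-y) 1 0
  simp only [rootNorm] at this
  calc _ = _ := Finset.prod_congr rfl fun k _ => by ring
    _ = _ := this
    _ = _ := by ring

end Norm

/-- The inclusion of `ℤ⟦X⟧` in `ℂ⟦X⟧`. -/
noncomputable def toComplex : ℤ⟦X⟧ →+* ℂ⟦X⟧ := map (Int.castRingHom ℂ)

theorem toComplex_injective : Function.Injective toComplex :=
  map_injective _ Int.cast_injective

/-- The substitution `X ↦ ω ^ k * X`. -/
noncomputable def rotate (ω : ℂ) (k : ℕ) : ℤ⟦X⟧ →+* ℂ⟦X⟧ := (rescale (ω ^ k)).comp toComplex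

theorem coeff_rotate (ω : ℂ) (k n : ℕ) (f : ℤ⟦X⟧) :
    coeff n (rotate ω k f) = (ω ^ k) ^ n * (coeff n f : ℤ) := by
  simp [rotate, toComplex]

theorem rotate_X (ω : ℂ) (k : ℕ) : rotate ω k X = C ω ^ k * X := by
  simp [rotate, toComplex, rescale_X]

theorem X_pow_dvd_map_sub (F : ℤ⟦X⟧ →+* ℂ⟦X⟧) (hF : X ∣ F X) {n m : ℕ} (h : n ≤ m) :
    X ^ n ∣ F euler - F (eulerProd m) := by
  rw [← map_sub]
  have h1 := map_dvd F ((pow_dvd_pow X (by omega)).trans (X_pow_dvd_euler_sub m) : X ^ n ∣ _)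
  rw [map_pow] at h1
  exact (pow_dvd_pow_of_dvd hF n).trans h1

theorem eq_of_forall_X_pow_dvd_sub {f g : ℂ⟦X⟧} (h : ∀ n : ℕ, X ^ n ∣ f - g) : f = g := by
  ext n
  have := X_pow_dvd_iff.mp (h (n + 1)) n (Nat.lt_succ_self n)
  rwa [map_sub, sub_eq_zero] at this

section Rotation

variable {ω : ℂ} (hω : IsPrimitiveRoot ω 7)

include hω

theorem rotate_eq_of_isHomog {s : ℕ} {f : ℤ⟦X⟧} (hf : IsHomog s f) (k : ℕ) :
    rotate ω k f = C ω ^ (s * k) * toComplex f := by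
  ext n
  rw [coeff_rotate, ← map_pow, coeff_C_mul, toComplex, coeff_map]
  by_cases h : (n : ZMod 7) = s
  · have hk : (ω ^ k) ^ 7 = 1 := by rw [← pow_mul, mul_comm, pow_mul, hω.pow_eq_one, one_pow]
    rw [mul_comm s, pow_mul, pow_eq_pow_mod n hk, pow_eq_pow_mod s hk,
      (ZMod.natCast_eq_natCast_iff' n s 7).mp h]
    rfl
  · simp [isHomog_iff.mp hf n h]

theorem prod_rotate_one_sub_X_pow_of_dvd {n : ℕ} (h : 7 ∣ n) :
    ∏ k ∈ Finset.range 7, rotate ω k (1 - X ^ n) = toComplex ((1 - X ^ n) ^ 7) := by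
  obtain ⟨m, rfl⟩ := h
  have hk (k : ℕ) : (C ω ^ k * (X : ℂ⟦X⟧)) ^ (7 * m) = X ^ (7 * m) := by
    rw [mul_pow, ← pow_mul, mul_left_comm, pow_mul, ← map_pow, hω.pow_eq_one, map_one, one_pow,
      one_mul]
  have hX : toComplex X = X := map_X _
  simp only [map_sub, map_one, map_pow, rotate_X, hk, hX, Finset.prod_const, Finset.card_range]

theorem prod_rotate_one_sub_X_pow_of_not_dvd {n : ℕ} (h : ¬ 7 ∣ n) :
    ∏ k ∈ Finset.range 7, rotate ω k (1 - X ^ n) = toComplex (expandSeven (1 - X ^ n)) := by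
  have hn : IsPrimitiveRoot (ω ^ n) 7 :=
    hω.pow_of_coprime n (((Nat.Prime.coprime_iff_not_dvd (by norm_num)).mpr h).symm)
  have hsum := congrArg (C : ℂ →+* ℂ⟦X⟧) (hn.geom_sum_eq_zero (by norm_num))
  simp only [Finset.sum_range_succ, Finset.sum_range_zero, zero_add, pow_zero, pow_one, map_add,
    map_one, map_pow, map_zero] at hsum
  have hX : toComplex X = X := map_X _
  rw [map_sub, map_one, map_pow, expand_X, map_sub, map_one, map_pow, map_pow, hX, ← pow_mul,
    mul_comm 7, pow_mul, ← prod_one_sub_pow_mul hsum]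
  refine Finset.prod_congr rfl fun k _ => ?_
  rw [map_sub, map_one, map_pow, rotate_X]
  ring

theorem prod_rotate_eulerProd (n : ℕ) :
    (∏ k ∈ Finset.range 7, rotate ω k (eulerProd (7 * n))) *
        toComplex (expandSeven (expandSeven (eulerProd n))) =
      toComplex (expandSeven (eulerProd (7 * n)) * expandSeven (eulerProd n) ^ 7) := by
  induction n with
  | zero => simp
  | succ n ih =>
    have h (i : ℕ) (hi : i < 6) :=
      prod_rotate_one_sub_X_pow_of_not_dvd hω (n := 7 * n + i + 1) (by omega)
    have h6 := prod_rotate_one_sub_X_pow_of_dvd hω (n := 7 * n + 6 + 1) (by omega)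
    have e : expandSeven (1 - X ^ (n + 1)) = 1 - X ^ (7 * n + 6 + 1) := by
      simp [← pow_mul, mul_add]
    rw [show 7 * (n + 1) = 7 * n + 6 + 1 by ring, eulerProd_succ, eulerProd_succ, eulerProd_succ,
      eulerProd_succ, eulerProd_succ, eulerProd_succ, eulerProd_succ, eulerProd_succ]
    simp only [map_mul, Finset.prod_mul_distrib, mul_pow, e]
    rw [h 5 (by norm_num), h 4 (by norm_num), h 3 (by norm_num), h 2 (by norm_num),
      h 1 (by norm_num), h 0 (by norm_num), h6]
    rw [map_mul, map_pow] at ih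
    simp only [map_pow]
    linear_combination toComplex (expandSeven (1 - X ^ (7 * n + 1))) *
      toComplex (expandSeven (1 - X ^ (7 * n + 1 + 1))) *
      toComplex (expandSeven (1 - X ^ (7 * n + 2 + 1))) *
      toComplex (expandSeven (1 - X ^ (7 * n + 3 + 1))) *
      toComplex (expandSeven (1 - X ^ (7 * n + 4 + 1))) *
      toComplex (expandSeven (1 - X ^ (7 * n + 5 + 1))) *
      toComplex (expandSeven (1 - X ^ (7 * n + 6 + 1))) *
      toComplex (1 - X ^ (7 * n + 6 + 1)) ^ 7 * ih

theorem prod_rotate_euler :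
    (∏ k ∈ Finset.range 7, rotate ω k euler) * toComplex (expandSeven (expandSeven euler)) =
      toComplex (expandSeven euler ^ 8) := by
  refine eq_of_forall_X_pow_dvd_sub fun n => ?_
  let q := Ideal.Quotient.mk (Ideal.span {(X : ℂ⟦X⟧) ^ n})
  have hq (F : ℤ⟦X⟧ →+* ℂ⟦X⟧) (hF : X ∣ F X) {m : ℕ} (h : n ≤ m) :
      q (F euler) = q (F (eulerProd m)) :=
    Ideal.Quotient.eq.mpr (Ideal.mem_span_singleton.mpr (X_pow_dvd_map_sub F hF h))
  have hX : toComplex X = X := map_X _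
  have h0 (k : ℕ) {m : ℕ} (h : n ≤ m) :=
    hq (rotate ω k) (by rw [rotate_X]; exact dvd_mul_left _ _) h
  have h1 {m : ℕ} (h : n ≤ m) := hq (toComplex.comp expandSeven.toRingHom)
    (by simp [hX]) h
  have h2 {m : ℕ} (h : n ≤ m) :=
    hq (toComplex.comp (expandSeven.toRingHom.comp expandSeven.toRingHom))
      (by simp [hX, ← pow_mul]) h
  rw [← Ideal.mem_span_singleton, ← Ideal.Quotient.eq]
  change q _ = q _
  have key := congrArg q (prod_rotate_eulerProd hω n)
  simp only [RingHom.comp_apply, AlgHom.toRingHom_eq_coe, RingHom.coe_coe] at h1 h2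
  simp only [map_mul, map_prod, map_pow] at key ⊢
  rw [← h2 le_rfl, ← h1 le_rfl, ← h1 (by omega),
    ← Finset.prod_congr rfl fun k _ => h0 k (by omega)] at key
  rw [key]
  ring


theorem prod_rotate_euler_eq_rootNorm :
    ∏ k ∈ Finset.range 7, rotate ω k euler = toComplex (rootNorm partA partB partC partD) := by
  have hsum := congrArg (C : ℂ →+* ℂ⟦X⟧) (hω.geom_sum_eq_zero (by norm_num))
  simp only [Finset.sum_range_succ, Finset.sum_range_zero, zero_add, pow_zero, pow_one, map_add,
    map_one, map_pow, map_zero] at hsum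
  rw [map_rootNorm, ← prod_conjugates hsum]
  refine Finset.prod_congr rfl fun k _ => ?_
  have hd : IsHomog (2 : ℕ) partD := by
    have := ((isHomog_X.pow 2).mul (isHomog_expandSeven (expandSeven euler)))
    simpa [partD] using this
  have ha := rotate_eq_of_isHomog hω (s := 5) (isHomog_comp 5 euler) k
  have hb := rotate_eq_of_isHomog hω (s := 1) (isHomog_comp 1 euler) k
  have hc := rotate_eq_of_isHomog hω (s := 0) (isHomog_comp 0 euler) k
  nth_rw 1 [euler_eq_parts]
  rw [map_sub, map_add, map_add, ha, hb, hc, rotate_eq_of_isHomog hω hd]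
  ring

end Rotation

theorem rootNorm_mul : rootNorm partA partB partC partD * expandSeven (expandSeven euler) =
    expandSeven euler ^ 8 := by
  have hω := Complex.isPrimitiveRoot_exp 7 (by norm_num)
  apply toComplex_injective
  rw [map_mul, ← prod_rotate_euler_eq_rootNorm hω, prod_rotate_euler hω]

theorem seriesW_sq_eq : seriesW ^ 2 = (X * expandSeven euler ^ 4) ^ 2 := by
  have h : rootNorm partA partB partC partD * partD = X ^ 2 * expandSeven euler ^ 8 := by
    rw [← rootNorm_mul, partD]
    ring
  have hw : rootNorm partA partB partC partD * partD - seriesW ^ 2 = 0 := by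
    rw [rootNorm, seriesW]
    linear_combination (-10 * partA ^ 3 * partB ^ 2 + 15 * partA ^ 3 * partC * partD -
      2 * partA ^ 2 *
      partC ^ 3 - 17 * partA * partB ^ 3 * partD + 55 * partA * partB * partC * partD
      ^ 2 - 2 * partB ^ 3 * partC ^ 2 + 15 * partB * partC ^ 3 * partD - 65 * partD ^
      5) * partA_mul_partB_mul_partC +
    (8 * partA ^ 4 * partB + 24 * partA ^ 2 * partB ^ 2 * partD - 24 * partA ^ 2 *
      partC * partD ^ 2 - 8 * partA * partC ^ 3 * partD + 8 * partB ^ 3 * partD ^ 2 +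
      24 * partB * partC * partD ^ 3 - partC ^ 5) * relation_two +
    (-partA ^ 5) * relation_five +
    (-partB ^ 5) * relation_four
  linear_combination h - hw

theorem constantCoeff_euler : constantCoeff euler = 1 := by
  rw [← coeff_zero_eq_constantCoeff_apply]
  exact coeff_pentagonalSeries_pentagonal ℤ 0

theorem coeff_one_seriesW : coeff 1 seriesW = 1 := by
  have h0 := constantCoeff_euler
  have h1 : coeff 1 euler = -1 := coeff_pentagonalSeries_pentagonal ℤ 1
  have h := congrArg (coeff 1) comp_one_euler_pow_four
  have hd : constantCoeff partD = 0 := by simp [partD]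
  have hd4 : coeff 1 (partD ^ 4) = 0 := by
    rw [coeff_one_pow, hd]; simp
  rw [coeff_comp, if_pos Nat.cast_one, coeff_one_pow, h1, h0, map_sub,
    show (-4 * seriesW : ℤ⟦X⟧) = C (-4) * seriesW by simp,
    show (7 * partD ^ 4 : ℤ⟦X⟧) = C 7 * partD ^ 4 by simp, coeff_C_mul, coeff_C_mul, hd4] at h
  norm_num at h
  omega

theorem seriesW_eq : seriesW = X * expandSeven euler ^ 4 := by
  refine (sq_eq_sq_iff_eq_or_eq_neg.mp seriesW_sq_eq).resolve_right fun h => ?_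
  have h1 := congrArg (coeff 1) h
  rw [coeff_one_seriesW, map_neg, ← zero_add 1, coeff_succ_X_mul] at h1
  simp [constantCoeff_euler] at h1

theorem comp_ofNat_mul (r : ZMod 7) (n : ℕ) [n.AtLeastTwo] (f : ℤ⟦X⟧) :
    comp r ((ofNat(n) : ℤ⟦X⟧) * f) = ofNat(n) * comp r f := by
  have h := isHomog_expandSeven (ofNat(n) : ℤ⟦X⟧)
  rw [map_ofNat] at h
  rw [h.comp_mul, sub_zero]

/-- The quotient `X ^ 2 * ∏ (1 - X ^ (49 * n)) / ∏ (1 - X ^ n)`. -/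
noncomputable def etaQuotient : ℤ⟦X⟧ := partD * partitionSeries

/-- The Hauptmodul `X * (∏ (1 - X ^ (7 * n)) / ∏ (1 - X ^ n)) ^ 4` of level `7`. -/
noncomputable def hauptmodul : ℤ⟦X⟧ := X * expandSeven euler ^ 4 * partitionSeries ^ 4

theorem euler_mul_etaQuotient : euler * etaQuotient = partD := by
  rw [etaQuotient]
  linear_combination partD * partitionSeries_mul_euler

theorem expandSeven_partitionSeries_mul :
    expandSeven partitionSeries * expandSeven euler = 1 := by
  rw [← map_mul, partitionSeries_mul_euler, map_one]

theorem seriesW_mul_expandSeven_hauptmodul : seriesW * expandSeven hauptmodul = partD ^ 4 := by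
  have h : (expandSeven partitionSeries * expandSeven euler) ^ 4 = 1 := by
    rw [expandSeven_partitionSeries_mul, one_pow]
  rw [seriesW_eq, hauptmodul, partD]
  simp only [map_mul, map_pow, expand_X]
  linear_combination X ^ 8 * expandSeven (expandSeven euler) ^ 4 * h

theorem expandSeven_hauptmodul_mul_hauptmodul :
    expandSeven hauptmodul * hauptmodul = etaQuotient ^ 4 := by
  rw [etaQuotient, mul_pow, ← seriesW_mul_expandSeven_hauptmodul, seriesW_eq]
  nth_rw 2 [hauptmodul]
  ring

theorem partD_ne_zero : partD ≠ 0 := by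
  intro h
  have h2 : euler ≠ 0 := right_ne_zero_of_mul_eq_one partitionSeries_mul_euler
  rw [partD] at h
  simp only [mul_eq_zero, pow_eq_zero_iff, X_ne_zero, ne_eq, OfNat.ofNat_ne_zero,
    not_false_eq_true, false_or, map_eq_zero_iff expandSeven expandSeven_injective] at h
  exact h2 h

theorem hauptmodul_ne_zero : hauptmodul ≠ 0 := by
  intro h
  have h1 := seriesW_mul_expandSeven_hauptmodul
  rw [h, map_zero, mul_zero] at h1
  exact pow_ne_zero 4 partD_ne_zero h1.symm

theorem isHomog_partD : IsHomog 2 partD := by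
  have := (isHomog_X.pow 2).mul (isHomog_expandSeven (expandSeven euler))
  simpa [partD] using this

theorem isHomog_seriesW : IsHomog 1 seriesW := by
  have := isHomog_X.mul (isHomog_expandSeven (euler ^ 4))
  simpa [seriesW_eq] using this

/-- The component of `E ^ k * x ^ i` in the class of `2 * k` modulo `7`, where `E` is the Euler
function and `x` is `etaQuotient`. -/
noncomputable def balancedComp (k i : ℕ) : ℤ⟦X⟧ :=
  comp (2 * (k : ZMod 7)) (euler ^ k * etaQuotient ^ i)

theorem balancedComp_succ_succ (k i : ℕ) :
    balancedComp (k + 1) (i + 1) = partD * balancedComp k i := by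
  have h : euler ^ (k + 1) * etaQuotient ^ (i + 1) = partD * (euler ^ k * etaQuotient ^ i) := by
    rw [← euler_mul_etaQuotient]
    ring
  rw [balancedComp, balancedComp, h, isHomog_partD.comp_mul]
  congr 3
  push_cast
  ring

theorem balancedComp_add (k i l : ℕ) :
    balancedComp (k + l) (i + l) = partD ^ l * balancedComp k i := by
  induction l with
  | zero => simp
  | succ l ih => rw [← add_assoc, ← add_assoc, balancedComp_succ_succ, ih, pow_succ']; ring

theorem balancedComp_recurrence (k i : ℕ) :
    partD ^ 7 * balancedComp k i =
      partD ^ 4 * expandSeven hauptmodul * (7 * balancedComp (k + 3) i +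
        35 * partD * balancedComp (k + 2) i + 49 * partD ^ 2 * balancedComp (k + 1) i) +
      expandSeven hauptmodul ^ 2 * (balancedComp (k + 7) i + 7 * partD * balancedComp (k + 6) i +
        21 * partD ^ 2 * balancedComp (k + 5) i + 49 * partD ^ 3 * balancedComp (k + 4) i +
        147 * partD ^ 4 * balancedComp (k + 3) i + 343 * partD ^ 5 * balancedComp (k + 2) i +
        343 * partD ^ 6 * balancedComp (k + 1) i) := by
  have key {s : ZMod 7} {g : ℤ⟦X⟧} (hg : IsHomog s g) (l : ℕ) (h : 2 - s = 2 * (l : ZMod 7)) :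
      comp (2 * (k : ZMod 7) + 2) (g * (euler ^ (k + l) * etaQuotient ^ i)) =
        g * balancedComp (k + l) i := by
    rw [hg.comp_mul, balancedComp]
    congr 3
    push_cast
    linear_combination h
  have hd (j : ℕ) := isHomog_partD.pow j
  have hw (j : ℕ) := (hd j).mul isHomog_seriesW
  have h : seriesW ^ 2 * (euler ^ (k + 0) * etaQuotient ^ i) =
      7 * (partD ^ 1 * seriesW * (euler ^ (k + 3) * etaQuotient ^ i)) +
      35 * (partD ^ 2 * seriesW * (euler ^ (k + 2) * etaQuotient ^ i)) +
      49 * (partD ^ 3 * seriesW * (euler ^ (k + 1) * etaQuotient ^ i)) +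
      partD ^ 1 * (euler ^ (k + 7) * etaQuotient ^ i) +
      7 * (partD ^ 2 * (euler ^ (k + 6) * etaQuotient ^ i)) +
      21 * (partD ^ 3 * (euler ^ (k + 5) * etaQuotient ^ i)) +
      49 * (partD ^ 4 * (euler ^ (k + 4) * etaQuotient ^ i)) +
      147 * (partD ^ 5 * (euler ^ (k + 3) * etaQuotient ^ i)) +
      343 * (partD ^ 6 * (euler ^ (k + 2) * etaQuotient ^ i)) +
      343 * (partD ^ 7 * (euler ^ (k + 1) * etaQuotient ^ i)) := by
    linear_combination euler ^ k * etaQuotient ^ i * seriesW_sq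
  replace h := congrArg (comp (2 * (k : ZMod 7) + 2)) h
  simp only [map_add, comp_ofNat_mul] at h
  rw [key (isHomog_seriesW.pow 2) 0 (by decide), key (hw 1) 3 (by decide), key (hw 2) 2 (by decide),
    key (hw 3) 1 (by decide), key (hd 1) 7 (by decide), key (hd 2) 6 (by decide),
    key (hd 3) 5 (by decide), key (hd 4) 4 (by decide), key (hd 5) 3 (by decide),
    key (hd 6) 2 (by decide), key (hd 7) 1 (by decide), add_zero] at h
  apply mul_left_cancel₀ partD_ne_zero
  have hwt := seriesW_mul_expandSeven_hauptmodul
  set t := expandSeven hauptmodul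
  linear_combination t ^ 2 * h + (7 * partD * balancedComp (k + 3) i +
    35 * partD ^ 2 * balancedComp (k + 2) i + 49 * partD ^ 3 * balancedComp (k + 1) i) * t * hwt -
    (seriesW * t + partD ^ 4) * balancedComp k i * hwt

/-- The seven-step recurrence satisfied by the components of the powers of `etaQuotient`. -/
theorem balancedComp_six_add_seven (i : ℕ) :
    balancedComp 6 (i + 7) =
      expandSeven hauptmodul * (7 * balancedComp 6 (i + 4) + 35 * balancedComp 6 (i + 5) +
        49 * balancedComp 6 (i + 6)) +
      expandSeven hauptmodul ^ 2 * (balancedComp 6 i + 7 * balancedComp 6 (i + 1) +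
        21 * balancedComp 6 (i + 2) + 49 * balancedComp 6 (i + 3) + 147 * balancedComp 6 (i + 4) +
        343 * balancedComp 6 (i + 5) + 343 * balancedComp 6 (i + 6)) := by
  apply mul_left_cancel₀ (pow_ne_zero 7 partD_ne_zero)
  rw [balancedComp_recurrence]
  have h (j l : ℕ) := balancedComp_add 6 (i + j) l
  have h1 := h 0 7
  have h2 := h 1 6
  have h3 := h 2 5
  have h4 := h 3 4
  have h5 := h 4 3
  have h6 := h 5 2
  have h7 := h 6 1
  simp only [Nat.reduceAdd, add_assoc, add_zero, pow_one] at *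
  rw [h1, h2, h3, h4, h5, h6, h7]
  ring

/-- The sparsity and `7`-divisibility satisfied by the polynomial in the Hauptmodul attached to
`balancedComp 6 i`. -/
def IsBounded (i : ℕ) (m : Polynomial ℤ) : Prop :=
  ∀ j, (7 * j + 5 < 2 * i → m.coeff j = 0) ∧ 7 ^ ((7 * j + 4 - 2 * i) / 4) ∣ m.coeff j

theorem IsBounded.add {i : ℕ} {m m' : Polynomial ℤ} (h : IsBounded i m) (h' : IsBounded i m') :
    IsBounded i (m + m') := fun j =>
  ⟨fun hj => by rw [Polynomial.coeff_add, (h j).1 hj, (h' j).1 hj, add_zero],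
    by rw [Polynomial.coeff_add]; exact dvd_add (h j).2 (h' j).2⟩

theorem IsBounded.shift {i : ℕ} {m : Polynomial ℤ} (h : IsBounded i m) (i' s e : ℕ) {c : ℤ}
    (hc : 7 ^ e ∣ c) (hi : 2 * i' ≤ 2 * i + 7 * s) (hs : 7 * s + 2 * i ≤ 2 * i' + 4 * e) :
    IsBounded i' (Polynomial.X ^ s * (Polynomial.C c * m)) := by
  intro j
  rw [Polynomial.coeff_X_pow_mul', Polynomial.coeff_C_mul]
  split_ifs with hj
  · obtain ⟨j, rfl⟩ := Nat.exists_eq_add_of_le' hj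
    rw [Nat.add_sub_cancel]
    refine ⟨fun hlt => by rw [(h j).1 (by omega), mul_zero], ?_⟩
    by_cases h0 : 7 * j + 5 < 2 * i
    · rw [(h j).1 h0, mul_zero]
      exact dvd_zero _
    · refine (pow_dvd_pow 7 ?_).trans ((pow_add (7 : ℤ) e _).symm ▸ mul_dvd_mul hc (h j).2)
      omega
  · simp

theorem balancedComp_zero_right (k : ℕ) :
    balancedComp k 0 = comp (2 * (k : ZMod 7)) (euler ^ k) := by
  rw [balancedComp, pow_zero, mul_one]

theorem isBounded_linear {i : ℕ} {a b : ℤ} (hi : i ≤ 6) (ha : a = 0 ∨ i = 1 ∨ i = 2)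
    (hb : 7 ^ ((11 - 2 * i) / 4) ∣ b) :
    IsBounded i (Polynomial.C a + Polynomial.C b * Polynomial.X) := by
  intro j
  match j with
  | 0 =>
    rw [Polynomial.coeff_add, Polynomial.coeff_C_zero, Polynomial.coeff_mul_X_zero, add_zero]
    obtain rfl | rfl | rfl := ha <;> simp
  | 1 =>
    rw [Polynomial.coeff_add, Polynomial.coeff_C_of_ne_zero one_ne_zero, Polynomial.coeff_C_mul,
      Polynomial.coeff_X_one, zero_add, mul_one b]
    exact ⟨fun _ => by omega, hb⟩
  | j + 2 =>
    rw [Polynomial.coeff_add, Polynomial.coeff_C_of_ne_zero (by omega), Polynomial.coeff_C_mul,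
      Polynomial.coeff_X_of_ne_one (by omega), zero_add, mul_zero]
    exact ⟨fun _ => rfl, dvd_zero _⟩

theorem exists_isBounded_of_eq_linear {i k : ℕ} {a b : ℤ} (hk : k + i = 6)
    (ha : a = 0 ∨ i = 1 ∨ i = 2) (hb : 7 ^ ((11 - 2 * i) / 4) ∣ b)
    (h : expandSeven hauptmodul * (partD ^ i * balancedComp k 0) =
      partD ^ 6 * (a + b * expandSeven hauptmodul)) :
    ∃ m, expandSeven hauptmodul * balancedComp 6 i =
      partD ^ 6 * Polynomial.aeval (expandSeven hauptmodul) m ∧ IsBounded i m := by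
  refine ⟨_, ?_, isBounded_linear (a := a) (b := b) (by omega) ha hb⟩
  have h' := balancedComp_add k 0 i
  rw [hk, zero_add] at h'
  rw [h', h]
  simp

theorem exists_isBounded (i : ℕ) :
    ∃ m, expandSeven hauptmodul * balancedComp 6 i =
      partD ^ 6 * Polynomial.aeval (expandSeven hauptmodul) m ∧ IsBounded i m := by
  have hwt := seriesW_mul_expandSeven_hauptmodul
  induction i using Nat.strong_induction_on with
  | h i ih =>
  match i with
  | 0 =>
    refine exists_isBounded_of_eq_linear (k := 6) (a := 0) (b := 49) rfl (by simp) (by norm_num) ?_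
    rw [balancedComp_zero_right, show 2 * ((6 : ℕ) : ZMod 7) = 5 by decide, comp_five_euler_pow_six]
    push_cast
    ring
  | 1 =>
    refine exists_isBounded_of_eq_linear (k := 5) (a := 10) (b := 49) rfl (by simp) (by norm_num) ?_
    rw [balancedComp_zero_right, show 2 * ((5 : ℕ) : ZMod 7) = 3 by decide,
      comp_three_euler_pow_five]
    push_cast
    linear_combination 10 * partD ^ 2 * hwt
  | 2 =>
    refine exists_isBounded_of_eq_linear (k := 4) (a := -4) (b := -7) rfl (by simp) (by norm_num) ?_
    rw [balancedComp_zero_right, show 2 * ((4 : ℕ) : ZMod 7) = 1 by decide, comp_one_euler_pow_four]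
    push_cast
    linear_combination -4 * partD ^ 2 * hwt
  | 3 =>
    refine exists_isBounded_of_eq_linear (k := 3) (a := 0) (b := -7) rfl (by simp) (by norm_num) ?_
    rw [balancedComp_zero_right, show 2 * ((3 : ℕ) : ZMod 7) = 6 by decide,
      comp_six_euler_cube_eq_partD]
    push_cast
    ring
  | 4 =>
    refine exists_isBounded_of_eq_linear (k := 2) (a := 0) (b := 1) rfl (by simp) (by norm_num) ?_
    rw [balancedComp_zero_right, show 2 * ((2 : ℕ) : ZMod 7) = 4 by decide, comp_four_euler_sq]
    push_cast
    ring
  | 5 =>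
    refine exists_isBounded_of_eq_linear (k := 1) (a := 0) (b := -1) rfl (by simp) (by norm_num) ?_
    rw [balancedComp_zero_right, show 2 * ((1 : ℕ) : ZMod 7) = 2 by decide, pow_one,
      comp_two_euler_eq_neg_partD]
    push_cast
    ring
  | 6 =>
    refine exists_isBounded_of_eq_linear (k := 0) (a := 0) (b := 1) rfl (by simp) (by norm_num) ?_
    rw [balancedComp_zero_right, show 2 * ((0 : ℕ) : ZMod 7) = 0 by decide, pow_zero,
      show comp 0 (1 : ℤ⟦X⟧) = 1 from isHomog_one]
    push_cast
    ring
  | i + 7 =>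
    obtain ⟨m₀, e₀, h₀⟩ := ih i (by omega)
    obtain ⟨m₁, e₁, h₁⟩ := ih (i + 1) (by omega)
    obtain ⟨m₂, e₂, h₂⟩ := ih (i + 2) (by omega)
    obtain ⟨m₃, e₃, h₃⟩ := ih (i + 3) (by omega)
    obtain ⟨m₄, e₄, h₄⟩ := ih (i + 4) (by omega)
    obtain ⟨m₅, e₅, h₅⟩ := ih (i + 5) (by omega)
    obtain ⟨m₆, e₆, h₆⟩ := ih (i + 6) (by omega)
    have b₁ := h₄.shift (i + 7) 1 1 (c := 7) (by norm_num) (by omega) (by omega)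
    have b₂ := h₅.shift (i + 7) 1 1 (c := 35) (by norm_num) (by omega) (by omega)
    have b₃ := h₆.shift (i + 7) 1 2 (c := 49) (by norm_num) (by omega) (by omega)
    have a₀ := h₀.shift (i + 7) 2 0 (c := 1) (by norm_num) (by omega) (by omega)
    have a₁ := h₁.shift (i + 7) 2 1 (c := 7) (by norm_num) (by omega) (by omega)
    have a₂ := h₂.shift (i + 7) 2 1 (c := 21) (by norm_num) (by omega) (by omega)
    have a₃ := h₃.shift (i + 7) 2 2 (c := 49) (by norm_num) (by omega) (by omega)
    have a₄ := h₄.shift (i + 7) 2 2 (c := 147) (by norm_num) (by omega) (by omega)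
    have a₅ := h₅.shift (i + 7) 2 3 (c := 343) (by norm_num) (by omega) (by omega)
    have a₆ := h₆.shift (i + 7) 2 3 (c := 343) (by norm_num) (by omega) (by omega)
    refine ⟨_, ?_, (b₁.add (b₂.add b₃)).add
      (a₀.add (a₁.add (a₂.add (a₃.add (a₄.add (a₅.add a₆))))))⟩
    rw [balancedComp_six_add_seven]
    simp only [map_add, map_mul, map_pow, Polynomial.aeval_X, map_ofNat,
      map_one]
    set t := expandSeven hauptmodul
    linear_combination t * (7 * e₄ + 35 * e₅ + 49 * e₆) + t ^ 2 * (e₀ + 7 * e₁ + 21 * e₂ +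
      49 * e₃ + 147 * e₄ + 343 * e₅ + 343 * e₆)

theorem exists_hauptmodul_mul_atkin (i : ℕ) :
    ∃ m, hauptmodul * atkin (etaQuotient ^ i) = Polynomial.aeval hauptmodul m ∧
      IsBounded (i + 6) m := by
  obtain ⟨m, h, hm⟩ := exists_isBounded (i + 6)
  refine ⟨m, expandSeven_injective (mul_left_cancel₀ (pow_ne_zero 6 partD_ne_zero) ?_), hm⟩
  have h0 := balancedComp_add 0 i 6
  rw [zero_add, balancedComp.eq_1 0, pow_zero, one_mul, Nat.cast_zero, mul_zero,
    ← expandSeven_atkin] at h0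
  rw [← Polynomial.aeval_algHom_apply, ← h, h0, map_mul expandSeven]
  ring

/-- The elements that are integral combinations of `7 ^ a j * y ^ (j + 1)` with `y` the
Hauptmodul. -/
noncomputable def hauptSpan (a : ℕ → ℕ) : Submodule ℤ ℤ⟦X⟧ :=
  Submodule.span ℤ (Set.range fun j => 7 ^ a j * hauptmodul ^ (j + 1))

theorem aeval_mem_hauptSpan {a : ℕ → ℕ} {P : Polynomial ℤ} (h0 : P.coeff 0 = 0)
    (h : ∀ j, 7 ^ a j ∣ P.coeff (j + 1)) : Polynomial.aeval hauptmodul P ∈ hauptSpan a := by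
  rw [Polynomial.aeval_def, Polynomial.eval₂_eq_sum_range]
  refine Submodule.sum_mem _ fun i _ => ?_
  match i with
  | 0 => simp [h0]
  | j + 1 =>
    obtain ⟨c, hc⟩ := h j
    have hc' : algebraMap ℤ ℤ⟦X⟧ (P.coeff (j + 1)) * hauptmodul ^ (j + 1) =
        c • (7 ^ a j * hauptmodul ^ (j + 1)) := by
      rw [hc, eq_intCast, zsmul_eq_mul]
      push_cast
      ring
    rw [hc']
    exact Submodule.smul_mem _ _ (Submodule.subset_span ⟨j, rfl⟩)

theorem mem_hauptSpan_of_isBounded {a : ℕ → ℕ} {i l : ℕ} {m : Polynomial ℤ} {f : ℤ⟦X⟧}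
    (hm : IsBounded l m) (h : hauptmodul ^ (i + 1) * f = Polynomial.aeval hauptmodul m)
    (hi : 7 * (i + 1) + 5 < 2 * l)
    (ha : ∀ j, a j ≤ (7 * (j + i + 2) + 4 - 2 * l) / 4) : f ∈ hauptSpan a := by
  obtain ⟨P, rfl⟩ := Polynomial.X_pow_dvd_iff.mpr
    fun d (hd : d < i + 1) => (hm d).1 (by omega)
  rw [map_mul, map_pow, Polynomial.aeval_X] at h
  rw [mul_left_cancel₀ (pow_ne_zero _ hauptmodul_ne_zero) h]
  refine aeval_mem_hauptSpan ?_ fun j => ?_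
  · have := (hm (i + 1)).1 hi
    rwa [Polynomial.coeff_X_pow_mul', if_pos le_rfl, Nat.sub_self] at this
  · have := (hm (j + i + 2)).2
    rw [show j + i + 2 = j + 1 + (i + 1) by ring, Polynomial.coeff_X_pow_mul] at this
    refine (pow_dvd_pow 7 ((ha j).trans_eq ?_)).trans this
    ring_nf

theorem atkin_hauptmodul_pow_mem (i : ℕ) :
    atkin (hauptmodul ^ (i + 1)) ∈ hauptSpan fun j => (7 * j + 5 - i) / 4 := by
  obtain ⟨m, h, hm⟩ := exists_hauptmodul_mul_atkin (4 * (i + 1))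
  rw [pow_mul, ← expandSeven_hauptmodul_mul_hauptmodul, mul_pow, ← map_pow expandSeven,
    atkin_expandSeven_mul, ← mul_assoc, ← pow_succ'] at h
  exact mem_hauptSpan_of_isBounded hm h (by omega) fun j => by omega

theorem atkin_etaQuotient_mul_hauptmodul_pow_mem (i : ℕ) :
    atkin (etaQuotient * hauptmodul ^ i) ∈ hauptSpan fun j => (7 * j + 4 - i) / 4 := by
  obtain ⟨m, h, hm⟩ := exists_hauptmodul_mul_atkin (4 * i + 1)
  rw [pow_succ, pow_mul, ← expandSeven_hauptmodul_mul_hauptmodul, mul_pow, mul_assoc,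
    mul_comm _ etaQuotient, ← map_pow expandSeven, atkin_expandSeven_mul, ← mul_assoc,
    ← pow_succ'] at h
  exact mem_hauptSpan_of_isBounded hm h (by omega) fun j => by omega

theorem seven_pow_mul_mem_hauptSpan {b c : ℕ → ℕ} {f : ℤ⟦X⟧} (hf : f ∈ hauptSpan b) (n : ℕ)
    (h : ∀ j, c j ≤ n + b j) : 7 ^ n * f ∈ hauptSpan c := by
  induction hf using Submodule.span_induction with
  | mem x hx =>
    obtain ⟨j, rfl⟩ := hx
    obtain ⟨d, hd⟩ := Nat.exists_eq_add_of_le' (h j)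
    have : (7 : ℤ⟦X⟧) ^ n * (7 ^ b j * hauptmodul ^ (j + 1)) =
        (7 ^ d : ℤ) • (7 ^ c j * hauptmodul ^ (j + 1)) := by
      rw [← mul_assoc, ← pow_add, hd, pow_add, zsmul_eq_mul]
      push_cast
      ring
    change (7 : ℤ⟦X⟧) ^ n * (7 ^ b j * hauptmodul ^ (j + 1)) ∈ _
    rw [this]
    exact Submodule.smul_mem _ _ (Submodule.subset_span ⟨j, rfl⟩)
  | zero => simp
  | add x y _ _ hx hy => rw [mul_add]; exact add_mem hx hy
  | smul r x _ hx => rw [mul_smul_comm]; exact Submodule.smul_mem _ _ hx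

theorem seven_pow_dvd_of_mem_hauptSpan {a : ℕ → ℕ} {f : ℤ⟦X⟧} (hf : f ∈ hauptSpan a) {n : ℕ}
    (h : ∀ j, n ≤ a j) : (7 : ℤ⟦X⟧) ^ n ∣ f := by
  induction hf using Submodule.span_induction with
  | mem x hx =>
    obtain ⟨j, rfl⟩ := hx
    exact Dvd.dvd.mul_right (pow_dvd_pow 7 (h j)) _
  | zero => exact dvd_zero _
  | add x y _ _ hx hy => exact dvd_add hx hy
  | smul r x _ hx => rw [zsmul_eq_mul]; exact Dvd.dvd.mul_left hx _

theorem atkin_mul_mem_hauptSpan {a c : ℕ → ℕ} {b : ℕ → ℕ → ℕ} {f g : ℤ⟦X⟧}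
    (hg : ∀ i, atkin (g * hauptmodul ^ (i + 1)) ∈ hauptSpan (b i))
    (hf : f ∈ hauptSpan a) (h : ∀ i j, c j ≤ a i + b i j) : atkin (g * f) ∈ hauptSpan c := by
  induction hf using Submodule.span_induction with
  | mem x hx =>
    obtain ⟨i, rfl⟩ := hx
    have : g * (7 ^ a i * hauptmodul ^ (i + 1)) =
        expandSeven (7 ^ a i) * (g * hauptmodul ^ (i + 1)) := by
      rw [map_pow, map_ofNat]
      ring
    change atkin (g * (7 ^ a i * hauptmodul ^ (i + 1))) ∈ _
    rw [this, atkin_expandSeven_mul]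
    exact seven_pow_mul_mem_hauptSpan (hg i) _ (h i)
  | zero => simp
  | add x y _ _ hx hy => rw [mul_add, map_add]; exact add_mem hx hy
  | smul r x _ hx => rw [mul_smul_comm, map_zsmul]; exact Submodule.smul_mem _ _ hx

/-- Twice the sum of the powers `49 ^ i` for `i < k`, that is `(49 ^ k - 1) / 24`. -/
def offset : ℕ → ℕ
  | 0 => 0
  | k + 1 => offset k + 2 * 49 ^ k

theorem offset_spec (k : ℕ) : 24 * offset k + 1 = 49 ^ k := by
  induction k with
  | zero => rfl
  | succ k ih => rw [offset, pow_succ, ← ih]; ring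

/-- The generating function of `p (49 ^ k * n - (49 ^ k - 1) / 24)`. -/
noncomputable def evenProgression (k : ℕ) : ℤ⟦X⟧ :=
  mk fun n => coeff (49 ^ k * n) (X ^ offset k * partitionSeries)

/-- The generating function of `p (7 * 49 ^ k * n - (49 ^ (k + 1) - 1) / 24)`. -/
noncomputable def oddProgression (k : ℕ) : ℤ⟦X⟧ :=
  mk fun n => coeff (7 * 49 ^ k * n) (X ^ offset (k + 1) * partitionSeries)

theorem evenProgression_zero : evenProgression 0 = partitionSeries := by
  ext n
  simp [evenProgression, offset]

theorem atkin_X_sq_mul_evenProgression (k : ℕ) :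
    atkin (X ^ 2 * evenProgression k) = oddProgression k := by
  ext n
  rw [coeff_atkin, oddProgression, coeff_mk, offset, add_comm (offset k), pow_add,
    mul_assoc (X ^ (2 * 49 ^ k)), coeff_X_pow_mul', coeff_X_pow_mul', evenProgression, coeff_mk]
  have h : 7 * 49 ^ k * n = 49 ^ k * (7 * n) := by ring
  rw [h, mul_comm 2, ← Nat.mul_sub]
  have hpos : 0 < 49 ^ k := by positivity
  simp only [Nat.mul_le_mul_left_iff hpos]

theorem atkin_oddProgression (k : ℕ) : atkin (oddProgression k) = evenProgression (k + 1) := by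
  ext n
  rw [coeff_atkin, oddProgression, evenProgression, coeff_mk, coeff_mk]
  congr 2
  ring

theorem etaQuotient_mul_euler_mul (f : ℤ⟦X⟧) :
    etaQuotient * (euler * f) = expandSeven (expandSeven euler) * (X ^ 2 * f) := by
  rw [← mul_assoc, mul_comm etaQuotient, euler_mul_etaQuotient, partD]
  ring

theorem expandSeven_euler_mul_oddProgression_zero_mem :
    expandSeven euler * oddProgression 0 ∈ hauptSpan fun j => 1 + 7 * j / 4 := by
  have h := atkin_etaQuotient_mul_hauptmodul_pow_mem 0
  rw [pow_zero, ← partitionSeries_mul_euler, mul_comm partitionSeries, etaQuotient_mul_euler_mul,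
    atkin_expandSeven_mul, ← evenProgression_zero, atkin_X_sq_mul_evenProgression] at h
  convert h using 3
  omega

theorem euler_mul_evenProgression_succ_mem {k : ℕ}
    (h : expandSeven euler * oddProgression k ∈ hauptSpan fun j => k + 1 + 7 * j / 4) :
    euler * evenProgression (k + 1) ∈ hauptSpan fun j => k + 1 + (7 * j + 5) / 4 := by
  rw [← atkin_oddProgression, ← atkin_expandSeven_mul, ← one_mul (_ * _)]
  refine atkin_mul_mem_hauptSpan (fun i => ?_) h (b := fun i j => (7 * j + 5 - i) / 4)
    fun i j => by rcases i with _ | i <;> omega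
  rw [one_mul]
  exact atkin_hauptmodul_pow_mem i

theorem expandSeven_euler_mul_oddProgression_succ_mem {k : ℕ}
    (h : euler * evenProgression (k + 1) ∈ hauptSpan fun j => k + 1 + (7 * j + 5) / 4) :
    expandSeven euler * oddProgression (k + 1) ∈ hauptSpan fun j => k + 2 + 7 * j / 4 := by
  rw [← atkin_X_sq_mul_evenProgression, ← atkin_expandSeven_mul, ← etaQuotient_mul_euler_mul]
  exact atkin_mul_mem_hauptSpan (fun i => atkin_etaQuotient_mul_hauptmodul_pow_mem (i + 1)) h
    fun i j => by omega

theorem expandSeven_euler_mul_oddProgression_mem (k : ℕ) :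
    expandSeven euler * oddProgression k ∈ hauptSpan fun j => k + 1 + 7 * j / 4 := by
  induction k with
  | zero => simpa only [zero_add] using expandSeven_euler_mul_oddProgression_zero_mem
  | succ k ih =>
    exact expandSeven_euler_mul_oddProgression_succ_mem (euler_mul_evenProgression_succ_mem ih)

theorem seven_pow_dvd_oddProgression (k : ℕ) : (7 : ℤ⟦X⟧) ^ (k + 1) ∣ oddProgression k := by
  have h := seven_pow_dvd_of_mem_hauptSpan (expandSeven_euler_mul_oddProgression_mem k)
    (n := k + 1) fun j => by omega
  have h' := h.mul_left (expandSeven partitionSeries)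
  rwa [← mul_assoc, expandSeven_partitionSeries_mul, one_mul] at h'

theorem seven_pow_dvd_evenProgression (k : ℕ) :
    (7 : ℤ⟦X⟧) ^ (k + 2) ∣ evenProgression (k + 1) := by
  have h := seven_pow_dvd_of_mem_hauptSpan
    (euler_mul_evenProgression_succ_mem (expandSeven_euler_mul_oddProgression_mem k))
    (n := k + 2) fun j => by omega
  have h' := h.mul_left partitionSeries
  rwa [← mul_assoc, partitionSeries_mul_euler, one_mul] at h'

theorem seven_pow_dvd_coeff {n : ℕ} {f : ℤ⟦X⟧} (h : (7 : ℤ⟦X⟧) ^ n ∣ f) (m : ℕ) :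
    7 ^ n ∣ coeff m f := by
  obtain ⟨g, rfl⟩ := h
  rw [← map_ofNat (C : ℤ →+* ℤ⟦X⟧) 7, ← map_pow, coeff_C_mul]
  exact dvd_mul_right _ _

theorem dvd_add_offset {n k N : ℕ} (hN : N ∣ 49 ^ k) (h : 24 * n ≡ 1 [MOD N]) :
    N ∣ n + offset k := by
  have h1 : N ∣ 24 * (n + offset k) := by
    rw [← Nat.modEq_zero_iff_dvd]
    calc 24 * (n + offset k) = 24 * n + 24 * offset k := mul_add _ _ _
      _ ≡ 1 + 24 * offset k [MOD N] := h.add_right _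
      _ = 49 ^ k := by rw [add_comm, offset_spec]
      _ ≡ 0 [MOD N] := Nat.modEq_zero_iff_dvd.mpr hN
  refine Nat.Coprime.dvd_of_dvd_mul_left (Nat.Coprime.coprime_dvd_left hN ?_) h1
  exact Nat.Coprime.pow_left k (by norm_num)

theorem coeff_add_X_pow_mul_partitionSeries (n r : ℕ) :
    coeff (n + r) (X ^ r * partitionSeries) = (Fintype.card (Nat.Partition n) : ℤ) := by
  rw [coeff_X_pow_mul, partitionSeries, coeff_mk]

theorem seven_pow_dvd_card_partition (n j : ℕ) (hj : 1 ≤ j) (h : 24 * n ≡ 1 [MOD 7 ^ j]) :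
    7 ^ (j / 2 + 1) ∣ Fintype.card (Nat.Partition n) := by
  obtain ⟨k, rfl | rfl⟩ : ∃ k, j = 2 * k + 1 ∨ j = 2 * (k + 1) := ⟨(j - 1) / 2, by omega⟩
  · have hN : 7 ^ (2 * k + 1) = 7 * 49 ^ k := by rw [pow_succ', pow_mul]; norm_num
    rw [hN] at h
    obtain ⟨m, hm⟩ := dvd_add_offset (k := k + 1) ⟨7, by ring⟩ h
    have := seven_pow_dvd_coeff (seven_pow_dvd_oddProgression k) m
    rw [oddProgression, coeff_mk, ← hm, coeff_add_X_pow_mul_partitionSeries] at this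
    rw [show (2 * k + 1) / 2 = k by omega]
    exact_mod_cast this
  · have hN : 7 ^ (2 * (k + 1)) = 49 ^ (k + 1) := by rw [pow_mul]; norm_num
    rw [hN] at h
    obtain ⟨m, hm⟩ := dvd_add_offset dvd_rfl h
    have := seven_pow_dvd_coeff (seven_pow_dvd_evenProgression k) m
    rw [evenProgression, coeff_mk, ← hm, coeff_add_X_pow_mul_partitionSeries] at this
    rw [show 2 * (k + 1) / 2 = k + 1 by omega]
    exact_mod_cast this

end PartitionModSeven

theorem stmt6 (n j : ℕ) (hj : 1 ≤ j) (h : 24 * n ≡ 1 [MOD 7 ^ j]) :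
    7 ^ (j / 2 + 1) ∣ partp n :=
  PartitionModSeven.seven_pow_dvd_card_partition n j hj h
end
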